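/- Let F be a field of characteristic 2, let φ be an anisotropic quadratic form over F of dimension 5 and type (1,3) that is not a Pfister neighbour, and let ψ be an anisotropic quadratic form over F of type (1,s) with s ≥ 4. Then the scalar extension φ_{F(ψ)} of φ to the function field F(ψ) is anisotropic. -/

import Mathlib

open QuadraticMap MvPolynomial
open scoped TensorProduct

set_option synthInstance.maxHeartbeats 1000000
set_option maxHeartbeats 1000000


section Defs

variable {K : Type} [CommRing K]

/-- The binary quadratic form `[a,b] : (x,y) ↦ a·x² + x·y + b·y²`. -/
noncomputable def binQF (a b : K) : QuadraticForm K (Fin 2 → K) :=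
  (Matrix.of ![![a, 1], ![0, b]]).toQuadraticMap'

/-- The diagonal (totally singular) quadratic form `⟨c₁, …, c_s⟩`. -/
noncomputable def diagQF {s : ℕ} (c : Fin s → K) : QuadraticForm K (Fin s → K) :=
  QuadraticMap.weightedSumSquares K c

/-- The orthogonal sum `[a₁,b₁] ⊥ ⋯ ⊥ [a_r,b_r]` of binary forms. -/
noncomputable def binsQF {r : ℕ} (a b : Fin r → K) : QuadraticForm K (Fin r → Fin 2 → K) :=
  QuadraticMap.pi fun i => binQF (a i) (b i)

/-- The orthogonal sum of `m` hyperbolic planes `[0,0]`. -/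
noncomputable def hypQF (K : Type) [CommRing K] (m : ℕ) :
    QuadraticForm K (Fin m → Fin 2 → K) :=
  binsQF (fun _ => 0) (fun _ => 0)

/-- The `(n+1)`-fold quadratic Pfister form `⟨⟨a₁,…,aₙ⟩⟩_b ⊗ [1,c]`, i.e. the orthogonal
sum over all subsets `S ⊆ {1,…,n}` of `(∏_{i∈S} aᵢ)·[1,c]`. -/
noncomputable def pfisterQF (n : ℕ) (a : Fin n → K) (c : K) :
    QuadraticForm K (Finset (Fin n) → Fin 2 → K) :=
  QuadraticMap.pi fun S : Finset (Fin n) => (∏ i ∈ S, a i) • binQF 1 c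

variable {V W : Type} [AddCommGroup V] [Module K V] [AddCommGroup W] [Module K W]

/-- `φ` has type `(r,s)`: it is isometric to `[a₁,b₁] ⊥ ⋯ ⊥ [a_r,b_r] ⊥ ⟨c₁,…,c_s⟩`. -/
def HasTypeRS (φ : QuadraticForm K V) (r s : ℕ) : Prop :=
  ∃ (a b : Fin r → K) (c : Fin s → K), φ.Equivalent ((binsQF a b).prod (diagQF c))

/-- `φ` is dominated by `ψ`. -/
def Dominated (φ : QuadraticForm K V) (ψ : QuadraticForm K W) : Prop :=
  ∃ f : V →ₗ[K] W, Function.Injective f ∧ ∀ v, φ v = ψ (f v)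

/-- `φ` is weakly dominated by `ψ`: `α·φ` is dominated by `ψ` for some unit `α`. -/
def WeaklyDominated (φ : QuadraticForm K V) (ψ : QuadraticForm K W) : Prop :=
  ∃ α : Kˣ, Dominated ((α : K) • φ) ψ

/-- Witt equivalence of quadratic forms. -/
def WittEquiv (Q₁ : QuadraticForm K V) (Q₂ : QuadraticForm K W) : Prop :=
  ∃ k l : ℕ, (Q₁.prod (hypQF K k)).Equivalent (Q₂.prod (hypQF K l))

/-- `φ` is a Pfister neighbour: there is a quadratic Pfister form `π` with
`2·dim φ > dim π` and `φ ≺_w π`. -/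
def IsPfisterNeighbour (φ : QuadraticForm K V) : Prop :=
  ∃ (n : ℕ) (a : Fin n → Kˣ) (c : K),
    2 * Module.finrank K V > 2 ^ (n + 1) ∧
      WeaklyDominated φ (pfisterQF n (fun i => (a i : K)) c)

/-- The Artin–Schreier set `℘(K) = {t² + t : t ∈ K}`. -/
def ArtinSchreier (K : Type) [CommRing K] : Set K := {x : K | ∃ t : K, x = t ^ 2 + t}

end Defs

section FunField

variable (F : Type) [Field F]

/-- The coefficient matrix of a quadratic form on `Fin n → F` with respect to the
standard basis: diagonal entries `ψ(eᵢ)`, above-diagonal entries `b_ψ(eᵢ,eⱼ)`. -/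
noncomputable def coeffMat {n : ℕ} (ψ : QuadraticForm F (Fin n → F)) :
    Matrix (Fin n) (Fin n) F :=
  Matrix.of fun i j =>
    if i = j then ψ (Pi.single i 1)
    else if i < j then polar ψ (Pi.single i 1) (Pi.single j 1) else 0

/-- The homogeneous degree 2 polynomial `P_ψ` associated to a quadratic form `ψ`. -/
noncomputable def qfPoly {n : ℕ} (ψ : QuadraticForm F (Fin n → F)) :
    MvPolynomial (Fin n) F :=
  ∑ i : Fin n, ∑ j : Fin n, MvPolynomial.C (coeffMat F ψ i j) * (X i * X j)

/-- The affine coordinate ring `F[x₁,…,xₙ]/(P_ψ)` of the quadric `ψ = 0`. -/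
def FunFieldRing {n : ℕ} (ψ : QuadraticForm F (Fin n → F)) : Type :=
  MvPolynomial (Fin n) F ⧸ Ideal.span {qfPoly F ψ}

noncomputable instance {n : ℕ} (ψ : QuadraticForm F (Fin n → F)) :
    CommRing (FunFieldRing F ψ) :=
  inferInstanceAs (CommRing (MvPolynomial (Fin n) F ⧸ Ideal.span {qfPoly F ψ}))

noncomputable instance {n : ℕ} (ψ : QuadraticForm F (Fin n → F)) :
    Algebra F (FunFieldRing F ψ) :=
  inferInstanceAs (Algebra F (MvPolynomial (Fin n) F ⧸ Ideal.span {qfPoly F ψ}))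

/-- The function field `F(ψ)` of the quadric `ψ = 0`. -/
def FunField {n : ℕ} (ψ : QuadraticForm F (Fin n → F)) : Type :=
  FractionRing (FunFieldRing F ψ)

noncomputable instance {n : ℕ} (ψ : QuadraticForm F (Fin n → F)) :
    CommRing (FunField F ψ) :=
  inferInstanceAs (CommRing (FractionRing (FunFieldRing F ψ)))

noncomputable instance {n : ℕ} (ψ : QuadraticForm F (Fin n → F)) :
    Algebra (FunFieldRing F ψ) (FunField F ψ) :=
  inferInstanceAs (Algebra (FunFieldRing F ψ) (FractionRing (FunFieldRing F ψ)))

noncomputable instance {n : ℕ} (ψ : QuadraticForm F (Fin n → F)) :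
    Algebra F (FunField F ψ) :=
  inferInstanceAs (Algebra F (FractionRing (FunFieldRing F ψ)))

/-- The canonical map `F → F(ψ)`. -/
noncomputable def funFieldMap {n : ℕ} (ψ : QuadraticForm F (Fin n → F)) :
    F →+* FunField F ψ :=
  algebraMap F (FunField F ψ)

/-- Scalar extension of a quadratic form on `Fin n → F` along a ring homomorphism
`f : F → K`. -/
noncomputable def extendQF {K : Type} [CommRing K] (f : F →+* K) {n : ℕ}
    (φ : QuadraticForm F (Fin n → F)) : QuadraticForm K (Fin n → K) :=
  ((coeffMat F φ).map f).toQuadraticMap'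

end FunField


section Quat

variable (K : Type) [CommRing K]

/-- Defining relations for the char-2 quaternion algebra `[a,b)`: generators `i,j` with
`i² + i = a`, `j² = b`, `j·i = i·j + j` (i.e. `j·i·j⁻¹ = i + 1`). -/
inductive QuatRel (a b : K) : FreeAlgebra K (Fin 2) → FreeAlgebra K (Fin 2) → Prop
  | i_sq : QuatRel a b (FreeAlgebra.ι K 0 * FreeAlgebra.ι K 0 + FreeAlgebra.ι K 0)
      (algebraMap K _ a)
  | j_sq : QuatRel a b (FreeAlgebra.ι K 1 * FreeAlgebra.ι K 1) (algebraMap K _ b)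
  | swap : QuatRel a b (FreeAlgebra.ι K 1 * FreeAlgebra.ι K 0)
      (FreeAlgebra.ι K 0 * FreeAlgebra.ι K 1 + FreeAlgebra.ι K 1)

/-- The quaternion algebra `[a,b)` over `K` (characteristic two convention). -/
def QuatAlg (a b : K) : Type := RingQuot (QuatRel K a b)

noncomputable instance (a b : K) : Ring (QuatAlg K a b) :=
  inferInstanceAs (Ring (RingQuot (QuatRel K a b)))
noncomputable instance (a b : K) : Algebra K (QuatAlg K a b) :=
  inferInstanceAs (Algebra K (RingQuot (QuatRel K a b)))

/-- `[a,b)` is split over `K`: isomorphic to the `2×2` matrix algebra. -/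
def QuatSplit (a b : K) : Prop :=
  Nonempty (QuatAlg K a b ≃ₐ[K] Matrix (Fin 2) (Fin 2) K)

end Quat

section Sqrt

variable (F : Type) [Field F]

/-- The field `F(√c₁,…,√c_s)` obtained by adjoining square roots of the `cᵢ`
(inside an algebraic closure of `F`). -/
noncomputable def sqrtExt {s : ℕ} (c : Fin s → F) :
    IntermediateField F (AlgebraicClosure F) :=
  IntermediateField.adjoin F
    {y : AlgebraicClosure F | ∃ i, y ^ 2 = algebraMap F (AlgebraicClosure F) (c i)}

/-- The subfield `F² = {x² : x ∈ F}` of squares of a field of characteristic 2. -/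
noncomputable def sqSubfield : Subfield F := Subfield.closure (Set.range fun x : F => x ^ 2)

set_option synthInstance.maxHeartbeats 1000000 in
/-- The norm degree `[F²(cᵢ·cⱼ) : F²]` of a diagonal form `⟨c₁,…,c_s⟩`. -/
noncomputable def normDegree {s : ℕ} (c : Fin s → F) : ℕ :=
  Module.finrank (sqSubfield F)
    (IntermediateField.adjoin (sqSubfield F)
      (Set.range fun p : Fin s × Fin s => c p.1 * c p.2))

end Sqrt

/-- A ring is a division algebra if it is nontrivial and every nonzero element is a unit. -/
def IsDivisionAlgebra (T : Type) [Ring T] : Prop :=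
  (0 : T) ≠ 1 ∧ ∀ x : T, x ≠ 0 → IsUnit x

/-- The value at `x` of the quadratic form with coefficient matrix `A`. -/
def matQF {ι S : Type} [Fintype ι] [CommRing S] (A : Matrix ι ι S) (x : ι → S) : S :=
  ∑ i, ∑ j, A i j * (x i * x j)

/-- The polar form of `matQF A`. -/
def matPolar {ι S : Type} [Fintype ι] [CommRing S] (A : Matrix ι ι S) (x y : ι → S) : S :=
  ∑ i, ∑ j, A i j * (x i * y j + y i * x j)

section MatQF

variable {ι S T : Type} [Fintype ι] [CommRing S] [CommRing T] (A : Matrix ι ι S)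

theorem matQF_comb (α β : S) (x y : ι → S) :
    matQF A (fun i => α * x i + β * y i) =
      α ^ 2 * matQF A x + α * β * matPolar A x y + β ^ 2 * matQF A y := by
  simp only [matQF, matPolar, Finset.mul_sum, ← Finset.sum_add_distrib]
  refine Finset.sum_congr rfl fun i _ => Finset.sum_congr rfl fun j _ => ?_
  ring

theorem matQF_smul (α : S) (x : ι → S) :
    matQF A (fun i => α * x i) = α ^ 2 * matQF A x := by
  simpa using matQF_comb A α 0 x x

theorem matPolar_comm (x y : ι → S) : matPolar A x y = matPolar A y x := by
  simp only [matPolar]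
  refine Finset.sum_congr rfl fun i _ => Finset.sum_congr rfl fun j _ => ?_
  ring

theorem matPolar_comb (α β : S) (x y z : ι → S) :
    matPolar A (fun i => α * x i + β * y i) z = α * matPolar A x z + β * matPolar A y z := by
  simp only [matPolar, Finset.mul_sum, ← Finset.sum_add_distrib]
  refine Finset.sum_congr rfl fun i _ => Finset.sum_congr rfl fun j _ => ?_
  ring

theorem matPolar_self [CharP S 2] (x : ι → S) : matPolar A x x = 0 := by
  simp only [matPolar, CharTwo.add_self_eq_zero, mul_zero, Finset.sum_const_zero]

theorem map_matQF (f : S →+* T) (x : ι → S) :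
    f (matQF A x) = matQF (A.map f) (fun i => f (x i)) := by
  simp [matQF]

theorem map_matPolar (f : S →+* T) (x y : ι → S) :
    f (matPolar A x y) = matPolar (A.map f) (fun i => f (x i)) (fun i => f (y i)) := by
  simp [matPolar]

end MatQF

/-- Anisotropy of `matQF A`. -/
def MatAniso {ι S : Type} [Fintype ι] [CommRing S] (A : Matrix ι ι S) : Prop :=
  ∀ x : ι → S, matQF A x = 0 → x = 0

section CasselsPfister

variable {ι k : Type} [Fintype ι] [Field k] {A : Matrix ι ι k}

theorem coeff_matQF_map (A : Matrix ι ι k) (p : ι → Polynomial k) (m : ℕ)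
    (hp : ∀ i, (p i).natDegree ≤ m) :
    (matQF (A.map Polynomial.C) p).coeff (2 * m) = matQF A (fun i => (p i).coeff m) := by
  simp only [matQF, Polynomial.finsetSum_coeff, Matrix.map_apply, Polynomial.coeff_C_mul]
  refine Finset.sum_congr rfl fun i _ => Finset.sum_congr rfl fun j _ => ?_
  rw [two_mul, Polynomial.coeff_mul_add_eq_of_natDegree_le (hp i) (hp j)]

theorem natDegree_matQF_map_le (A : Matrix ι ι k) (p : ι → Polynomial k) (m : ℕ)
    (hp : ∀ i, (p i).natDegree ≤ m) :
    (matQF (A.map Polynomial.C) p).natDegree ≤ 2 * m := by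
  refine Polynomial.natDegree_sum_le_of_forall_le _ _ fun i _ =>
    Polynomial.natDegree_sum_le_of_forall_le _ _ fun j _ => ?_
  refine (Polynomial.natDegree_C_mul_le _ _).trans (Polynomial.natDegree_mul_le.trans ?_)
  have := hp i
  have := hp j
  omega

theorem exists_natDegree_bound (p : ι → Polynomial k) (hp : p ≠ 0) :
    ∃ m, (∀ i, (p i).natDegree ≤ m) ∧ (fun i => (p i).coeff m) ≠ 0 := by
  classical
  obtain ⟨i₁, hi₁⟩ := Function.ne_iff.1 hp
  obtain ⟨i₀, hi₀, hmax⟩ := Finset.exists_max_image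
    (Finset.univ.filter fun i => p i ≠ 0) (fun i => (p i).natDegree)
    ⟨i₁, by simpa using hi₁⟩
  refine ⟨(p i₀).natDegree, fun i => ?_, fun h => ?_⟩
  · by_cases h : p i = 0
    · simp [h]
    · exact hmax i (by simpa using h)
  · have := congrFun h i₀
    simp at this hi₀
    exact hi₀ this

theorem matAniso_map_C (hA : MatAniso A) : MatAniso (A.map Polynomial.C) := by
  intro p hp
  by_contra h
  obtain ⟨m, hm, hm0⟩ := exists_natDegree_bound p h
  refine hm0 (hA _ ?_)
  rw [← coeff_matQF_map A p m hm, hp, Polynomial.coeff_zero]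

/-- The Cassels-Pfister theorem in characteristic two. -/
theorem cassels_pfister [CharP k 2] (hA : MatAniso A) (f : Polynomial k) :
    ∀ (h : Polynomial k) (p : ι → Polynomial k), h ≠ 0 →
      matQF (A.map Polynomial.C) p = f * h ^ 2 → ∃ p', matQF (A.map Polynomial.C) p' = f := by
  intro h
  induction hn : h.natDegree using Nat.strong_induction_on generalizing h with
  | _ n ih =>
  subst hn
  intro p h0 hp
  have hch : (2 : Polynomial k) = 0 := CharTwo.two_eq_zero
  set g : ι → Polynomial k := fun i => p i / h
  set r : ι → Polynomial k := fun i => 1 * p i + h * g i with hr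
  have hmod : ∀ i, r i = p i % h := fun i => by
    have := EuclideanDomain.div_add_mod (p i) h
    simp only [hr, g]
    linear_combination -this + (h * (p i / h)) * hch
  by_cases hr0 : r = 0
  · refine ⟨g, ?_⟩
    have hpg : p = fun i => h * g i := by
      funext i
      have := congrFun hr0 i
      simp only [hr, Pi.zero_apply] at this
      linear_combination this - h * g i * hch
    rw [hpg, matQF_smul] at hp
    exact mul_left_cancel₀ (pow_ne_zero 2 h0) (by rw [hp]; ring)
  set Q := matQF (A.map Polynomial.C) g
  set b := matPolar (A.map Polynomial.C) p g
  have hqr : matQF (A.map Polynomial.C) r = h * (f * h + b + h * Q) := by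
    rw [hr, matQF_comb, hp]; ring
  have hqr0 : matQF (A.map Polynomial.C) r ≠ 0 := fun hz => hr0 (matAniso_map_C hA r hz)
  have hh' : f * h + b + h * Q ≠ 0 := fun hz => hqr0 (by rw [hqr, hz, mul_zero])
  have hdeg : ∀ i, (r i).natDegree ≤ h.natDegree - 1 := by
    intro i
    by_cases hri : r i = 0
    · simp [hri]
    have : (r i).degree < h.degree := by rw [hmod]; exact EuclideanDomain.mod_lt _ h0
    have := Polynomial.natDegree_lt_natDegree hri this
    omega
  have hpos : 0 < h.natDegree := by
    obtain ⟨i, hi⟩ := Function.ne_iff.1 hr0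
    have : (r i).degree < h.degree := by rw [hmod]; exact EuclideanDomain.mod_lt _ h0
    have := Polynomial.natDegree_lt_natDegree hi this
    omega
  refine ih _ ?_ (f * h + b + h * Q) rfl
    (fun i => (f + Q) * p i + b * g i) hh' ?_
  · have := natDegree_matQF_map_le A r _ hdeg
    rw [hqr, Polynomial.natDegree_mul h0 hh'] at this
    omega
  · rw [matQF_comb, hp]
    change (f + Q) ^ 2 * (f * h ^ 2) + (f + Q) * b * b + b ^ 2 * Q = _
    linear_combination (-f * b * h * f - f * b * h * Q + b ^ 2 * Q) * hch

theorem exists_linear_representation [CharP k 2] (hA : MatAniso A) (f₀ f₁ f₂ : k)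
    (p : ι → RatFunc k)
    (hp : matQF (A.map RatFunc.C) p =
      RatFunc.C f₀ + RatFunc.C f₁ * RatFunc.X + RatFunc.C f₂ * RatFunc.X ^ 2) :
    ∃ p₀ p₁ : ι → k, matQF A p₀ = f₀ ∧ matPolar A p₀ p₁ = f₁ ∧ matQF A p₁ = f₂ := by
  classical
  obtain ⟨⟨h, hh⟩, hint⟩ := IsLocalization.exist_integer_multiples_of_finite
    (nonZeroDivisors (Polynomial k)) p
  choose P hP using hint
  have h0 : h ≠ 0 := nonZeroDivisors.ne_zero hh
  have hinj := IsFractionRing.injective (Polynomial k) (RatFunc k)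
  have hAm : A.map RatFunc.C =
      (A.map Polynomial.C).map (algebraMap (Polynomial k) (RatFunc k)) := by
    ext i j; simp
  set f : Polynomial k :=
    Polynomial.C f₀ + Polynomial.C f₁ * Polynomial.X + Polynomial.C f₂ * Polynomial.X ^ 2 with hf
  have hPeq : matQF (A.map Polynomial.C) P = f * h ^ 2 := by
    apply hinj
    rw [map_matQF, ← hAm]
    have : (fun i => algebraMap (Polynomial k) (RatFunc k) (P i)) =
        fun i => algebraMap (Polynomial k) (RatFunc k) h * p i := by
      funext i; rw [hP i, Algebra.smul_def]
    rw [this, matQF_smul, hp, hf]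
    simp
    ring
  obtain ⟨p', hp'⟩ := cassels_pfister hA f h P h0 hPeq
  have hfdeg : f.natDegree ≤ 2 := by rw [hf]; compute_degree
  have hdeg : ∀ i, (p' i).natDegree ≤ 1 := by
    by_contra hcon
    push Not at hcon
    obtain ⟨i, hi⟩ := hcon
    have hne : p' ≠ 0 := fun h => by simp [h] at hi
    obtain ⟨m, hm, hm0⟩ := exists_natDegree_bound p' hne
    refine hm0 (hA _ ?_)
    rw [← coeff_matQF_map A p' m hm, hp']
    apply Polynomial.coeff_eq_zero_of_natDegree_lt
    have := hm i
    omega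
  refine ⟨fun i => (p' i).coeff 0, fun i => (p' i).coeff 1, ?_⟩
  have hp'' : p' = fun i => 1 * Polynomial.C ((p' i).coeff 0) +
      Polynomial.X * Polynomial.C ((p' i).coeff 1) := by
    funext i
    conv_lhs => rw [Polynomial.eq_X_add_C_of_natDegree_le_one (hdeg i)]
    ring
  rw [hp'', matQF_comb, ← map_matQF, ← map_matQF, ← map_matPolar] at hp'
  set q₀ := matQF A fun i => (p' i).coeff 0
  set q₁ := matQF A fun i => (p' i).coeff 1
  set b := matPolar A (fun i => (p' i).coeff 0) fun i => (p' i).coeff 1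
  have e0 := congrArg (fun q => Polynomial.coeff q 0) hp'
  have e1 := congrArg (fun q => Polynomial.coeff q 1) hp'
  have e2 := congrArg (fun q => Polynomial.coeff q 2) hp'
  simp [hf, Polynomial.coeff_X, Polynomial.coeff_C] at e0 e1 e2
  exact ⟨e0, e1, e2⟩

/-- A quadratic form over `k(t)` with anisotropic reduction at infinity is anisotropic. -/
theorem matAniso_ratFunc (hA : MatAniso A) (B : Matrix ι ι k) (p : ι → RatFunc k)
    (hp : RatFunc.X * matQF (A.map RatFunc.C) p + matQF (B.map RatFunc.C) p = 0) : p = 0 := by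
  classical
  obtain ⟨⟨h, hh⟩, hint⟩ := IsLocalization.exist_integer_multiples_of_finite
    (nonZeroDivisors (Polynomial k)) p
  choose P hP using hint
  have h0 : h ≠ 0 := nonZeroDivisors.ne_zero hh
  have hinj := IsFractionRing.injective (Polynomial k) (RatFunc k)
  have hm : ∀ M : Matrix ι ι k, M.map RatFunc.C =
      (M.map Polynomial.C).map (algebraMap (Polynomial k) (RatFunc k)) := by
    intro M; ext i j; simp
  have hPp : (fun i => algebraMap (Polynomial k) (RatFunc k) (P i)) =
      fun i => algebraMap (Polynomial k) (RatFunc k) h * p i := by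
    funext i; rw [hP i, Algebra.smul_def]
  have hPeq : Polynomial.X * matQF (A.map Polynomial.C) P + matQF (B.map Polynomial.C) P = 0 := by
    apply hinj
    rw [map_add, map_mul, map_matQF, map_matQF, ← hm, ← hm, hPp, matQF_smul, matQF_smul, map_zero,
      RatFunc.algebraMap_X]
    linear_combination (algebraMap (Polynomial k) (RatFunc k) h) ^ 2 * hp
  have hP0 : P = 0 := by
    by_contra hne
    obtain ⟨m, hm, hm0⟩ := exists_natDegree_bound P hne
    refine hm0 (hA _ ?_)
    have := congrArg (fun q => Polynomial.coeff q (2 * m + 1)) hPeq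
    simp only [Polynomial.coeff_add, Polynomial.coeff_X_mul, Polynomial.coeff_zero] at this
    rwa [coeff_matQF_map A P m hm, Polynomial.coeff_eq_zero_of_natDegree_lt (p := matQF _ _),
      add_zero] at this
    have := natDegree_matQF_map_le B P m hm
    omega
  funext i
  have := congrFun hPp i
  rw [hP0] at this
  simp only [Pi.zero_apply, map_zero] at this
  have hne : algebraMap (Polynomial k) (RatFunc k) h ≠ 0 := fun hz =>
    h0 (hinj (by rw [hz, map_zero]))
  exact (mul_eq_zero.1 this.symm).resolve_left hne

end CasselsPfister

/-- The properties of a rational function field `E = k(t)` needed to descend representations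
by anisotropic quadratic forms from `E` to `k`. -/
structure IsRationalExtension {k E : Type} [Field k] [Field E] (c : k →+* E) (t : E) : Prop where
  transcendental : ∀ p : Polynomial k, p.eval₂ c t = 0 → p = 0
  exists_linear_representation : ∀ {ι : Type} [Fintype ι] (A : Matrix ι ι k), MatAniso A →
    ∀ (f₀ f₁ f₂ : k) (p : ι → E), matQF (A.map c) p = c f₀ + c f₁ * t + c f₂ * t ^ 2 →
      ∃ p₀ p₁ : ι → k, matQF A p₀ = f₀ ∧ matPolar A p₀ p₁ = f₁ ∧ matQF A p₁ = f₂
  eq_zero_of_isotropic : ∀ {ι : Type} [Fintype ι] (A B : Matrix ι ι k), MatAniso A →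
    ∀ p : ι → E, t * matQF (A.map c) p + matQF (B.map c) p = 0 → p = 0

theorem exists_isRationalExtension (k : Type) [Field k] [CharP k 2] :
    ∃ (E : Type) (_ : Field E) (_ : CharP E 2) (c : k →+* E) (t : E), IsRationalExtension c t := by
  refine ⟨RatFunc k, inferInstance,
    charP_of_injective_algebraMap (algebraMap k (RatFunc k)).injective 2, RatFunc.C, RatFunc.X,
    fun p hp => ?_, fun A hA => exists_linear_representation hA,
    fun A B hA => matAniso_ratFunc hA B⟩
  have h : ∀ q : Polynomial k, algebraMap (Polynomial k) (RatFunc k) q =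
      q.eval₂ RatFunc.C RatFunc.X := fun q => by
    induction q using Polynomial.induction_on' with
    | add p q h1 h2 => rw [map_add, Polynomial.eval₂_add, h1, h2]
    | monomial n a => simp [← Polynomial.C_mul_X_pow_eq_monomial]
  exact IsFractionRing.injective (Polynomial k) (RatFunc k) (by rw [h, hp, map_zero])

section IsRationalExtension

variable {ι k E : Type} [Fintype ι] [Field k] [Field E] {A : Matrix ι ι k} {c : k →+* E} {t : E}

theorem IsRationalExtension.matAniso (hc : IsRationalExtension c t) (hA : MatAniso A) :
    MatAniso (A.map c) := fun p hp =>
  hc.eq_zero_of_isotropic A 0 hA p (by rw [hp]; simp [matQF])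

theorem IsRationalExtension.exists_representation_orthogonal [CharP k 2]
    (hc : IsRationalExtension c t)
    (hA : MatAniso A) (s : ι → k) (f : k)
    (p : ι → E)
    (hp : matQF (A.map c) p = c f + c (matQF A s) * t ^ 2) :
    ∃ p₀ : ι → k, matQF A p₀ = f ∧ matPolar A p₀ s = 0 := by
  obtain ⟨p₀, p₁, h0, h01, h1⟩ := hc.exists_linear_representation A hA f 0 (matQF A s) p
    (by rw [hp]; simp)
  have hch : (2 : k) = 0 := CharTwo.two_eq_zero
  set r : ι → k := fun i => 1 * p₁ i + 1 * s i with hr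
  have hqr : matQF A r = matPolar A p₁ s := by
    rw [hr, matQF_comb, h1]; linear_combination matQF A s * hch
  by_cases hr0 : r = 0
  · refine ⟨p₀, h0, ?_⟩
    have : s = p₁ := by
      funext i
      have := congrFun hr0 i
      simp only [hr, Pi.zero_apply] at this
      linear_combination this - p₁ i * hch
    rw [this, h01]
  have hq0 : matQF A r ≠ 0 := fun h => hr0 (hA r h)
  have hbr : matPolar A p₀ r = matPolar A p₀ s := by
    rw [matPolar_comm, hr, matPolar_comb, matPolar_comm A p₁, h01, matPolar_comm A s]; ring
  have hrs : matPolar A r s = matQF A r := by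
    rw [hr, matPolar_comb, matPolar_self, ← hr, hqr]; ring
  refine ⟨fun i => 1 * p₀ i + matPolar A p₀ s / matQF A r * r i, ?_, ?_⟩
  · rw [matQF_comb, h0, hbr]
    field_simp
    linear_combination matPolar A p₀ s ^ 2 * hch
  · rw [matPolar_comb, hrs]
    field_simp
    linear_combination matPolar A p₀ s * hch

end IsRationalExtension

section Descent

variable {k : Type} [Field k]

/-- The coefficient matrix of `[a,b] ⊥ ⟨1⟩`. -/
def binOneMat (a b : k) : Matrix (Fin 3) (Fin 3) k := !![a, 1, 0; 0, b, 0; 0, 0, 1]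

theorem matQF_binOneMat (a b : k) (x : Fin 3 → k) :
    matQF (binOneMat a b) x = a * x 0 ^ 2 + x 0 * x 1 + b * x 1 ^ 2 + x 2 ^ 2 := by
  simp [matQF, binOneMat, Fin.sum_univ_succ]
  ring

theorem binOneMat_map {k' : Type} [Field k'] (f : k →+* k') (a b : k) :
    (binOneMat a b).map f = binOneMat (f a) (f b) := by
  ext i j
  fin_cases i <;> fin_cases j <;> simp [binOneMat]

theorem matPolar_binOneMat [CharP k 2] (a b : k) (x y : Fin 3 → k) :
    matPolar (binOneMat a b) x y = x 0 * y 1 + x 1 * y 0 := by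
  have hch : (2 : k) = 0 := CharTwo.two_eq_zero
  simp [matPolar, binOneMat, Fin.sum_univ_succ]
  linear_combination (a * x 0 * y 0 + b * x 1 * y 1 + x 2 * y 2) * hch

/-- The coefficient matrix of `⟨d,1⟩`. -/
def diagOneMat (d : k) : Matrix (Fin 2) (Fin 2) k := !![d, 0; 0, 1]

theorem matQF_diagOneMat (d : k) (x : Fin 2 → k) :
    matQF (diagOneMat d) x = d * x 0 ^ 2 + x 1 ^ 2 := by
  simp [matQF, diagOneMat, Fin.sum_univ_succ]
  ring

theorem diagOneMat_map {k' : Type} [Field k'] (f : k →+* k') (d : k) :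
    (diagOneMat d).map f = diagOneMat (f d) := by
  ext i j
  fin_cases i <;> fin_cases j <;> simp [diagOneMat]

theorem matPolar_diagOneMat [CharP k 2] (d : k) (x y : Fin 2 → k) :
    matPolar (diagOneMat d) x y = 0 := by
  have hch : (2 : k) = 0 := CharTwo.two_eq_zero
  simp [matPolar, diagOneMat, Fin.sum_univ_succ]
  linear_combination (d * x 0 * y 0 + x 1 * y 1) * hch

theorem matAniso_diagOneMat [CharP k 2] {d : k} (hd : ∀ r, r ^ 2 ≠ d) :
    MatAniso (diagOneMat d) := by
  intro x hx
  have hch : (2 : k) = 0 := CharTwo.two_eq_zero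
  rw [matQF_diagOneMat] at hx
  have h0 : x 0 = 0 := by
    by_contra h
    refine hd (x 1 / x 0) ?_
    field_simp
    linear_combination hx - d * x 0 ^ 2 * hch
  have h1 : x 1 = 0 := by simpa [h0] using hx
  funext i
  fin_cases i <;> simp [h0, h1]

theorem exists_sq_eq_of_representation {k₁ k₂ : Type} [Field k₁] [Field k₂] [CharP k 2]
    [CharP k₁ 2] {c : k →+* k₁} {c' : k₁ →+* k₂} {x : k₁} {z : k₂}
    (hc : IsRationalExtension c x) (hc' : IsRationalExtension c' z) {a b d e η g : k}
    (hA : MatAniso (binOneMat a b)) (hη : η ≠ 0) (p : Fin 3 → k₂)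
    (hp : matQF (((binOneMat a b).map c).map c') p =
      c' (c g + c η * x + c e * x ^ 2) + c' (c d) * z ^ 2) :
    ∃ r, r ^ 2 = d := by
  by_contra hd
  push Not at hd
  have hD := matAniso_diagOneMat hd
  obtain ⟨p₀, p₁, h0, h01, h1⟩ := hc'.exists_linear_representation _ (hc.matAniso hA)
    (c g + c η * x + c e * x ^ 2) 0
    (c d) p (by rw [hp]; simp)
  have hch : (2 : k₁) = 0 := CharTwo.two_eq_zero
  rw [binOneMat_map] at h0 h01 h1
  rw [matQF_binOneMat] at h0 h1
  rw [matPolar_binOneMat] at h01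
  have key : ∀ μ : k₁, p₀ 0 = μ * p₁ 0 → p₀ 1 = μ * p₁ 1 → False := by
    intro μ e0 e1
    obtain ⟨q₀, q₁, -, hq, -⟩ := hc.exists_linear_representation _ hD g η e
      ![μ, p₀ 2 + μ * p₁ 2] (by
        rw [diagOneMat_map, matQF_diagOneMat, ← h0, e0, e1, ← h1]
        simp
        linear_combination (μ ^ 2 * p₁ 2 ^ 2 + μ * p₁ 2 * p₀ 2) * hch)
    rw [matPolar_diagOneMat] at hq
    exact hη hq.symm
  by_cases hX : p₁ 0 = 0
  · by_cases hY : p₁ 1 = 0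
    · have := hc.matAniso hD ![1, p₁ 2] (by
        rw [diagOneMat_map, matQF_diagOneMat, ← h1, hX, hY]
        simp
        linear_combination (p₁ 2 ^ 2) * hch)
      simpa using congrFun this 0
    · refine key (p₀ 1 / p₁ 1) ?_ (by field_simp)
      field_simp
      linear_combination h01 - p₀ 1 * p₁ 0 * hch
  · refine key (p₀ 0 / p₁ 0) (by field_simp) ?_
    field_simp
    linear_combination h01 - p₀ 0 * p₁ 1 * hch

/-- The coefficient matrix of the form
`x₀² + c₂x₁² + c₃x₂² + c₂c₃x₃² + a(y₀² + c₂y₁² + c₃y₂²) + s(x₃y₀ + x₂y₁ + x₁y₂)`. -/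
def sevenMat (c₂ c₃ a s : k) : Matrix (Fin 7) (Fin 7) k :=
  !![1, 0, 0, 0, 0, 0, 0;
     0, c₂, 0, 0, 0, 0, s;
     0, 0, c₃, 0, 0, s, 0;
     0, 0, 0, c₂ * c₃, s, 0, 0;
     0, 0, 0, 0, a, 0, 0;
     0, 0, 0, 0, 0, a * c₂, 0;
     0, 0, 0, 0, 0, 0, a * c₃]

theorem matQF_sevenMat (c₂ c₃ a s : k) (x : Fin 7 → k) :
    matQF (sevenMat c₂ c₃ a s) x = x 0 ^ 2 + c₂ * x 1 ^ 2 + c₃ * x 2 ^ 2 + c₂ * c₃ * x 3 ^ 2 +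
      a * (x 4 ^ 2 + c₂ * x 5 ^ 2 + c₃ * x 6 ^ 2) +
      s * (x 3 * x 4 + x 2 * x 5 + x 1 * x 6) := by
  simp [matQF, sevenMat, Fin.sum_univ_seven]
  ring

theorem sevenMat_map {k' : Type} [Field k'] (f : k →+* k') (c₂ c₃ a s : k) :
    (sevenMat c₂ c₃ a s).map f = sevenMat (f c₂) (f c₃) (f a) (f s) := by
  ext i j
  fin_cases i <;> fin_cases j <;> simp [sevenMat]

theorem matPolar_sevenMat [CharP k 2] (c₂ c₃ a s : k) (x y : Fin 7 → k) :
    matPolar (sevenMat c₂ c₃ a s) x y = s * (x 3 * y 4 + x 2 * y 5 + x 1 * y 6 +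
      y 3 * x 4 + y 2 * x 5 + y 1 * x 6) := by
  have hch : (2 : k) = 0 := CharTwo.two_eq_zero
  simp [matPolar, sevenMat, Fin.sum_univ_seven]
  linear_combination (x 0 * y 0 + c₂ * x 1 * y 1 + c₃ * x 2 * y 2 + c₂ * c₃ * x 3 * y 3 +
    a * (x 4 * y 4 + c₂ * x 5 * y 5 + c₃ * x 6 * y 6)) * hch

/-- The restriction of the form of `sevenMat` to `y₂ = 0`. -/
def sixMat (c₂ c₃ a s : k) : Matrix (Fin 6) (Fin 6) k :=
  (sevenMat c₂ c₃ a s).submatrix Fin.castSucc Fin.castSucc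

/-- The restriction of the form of `sevenMat` to `y₁ = y₂ = 0`. -/
def fiveMat (c₂ c₃ a s : k) : Matrix (Fin 5) (Fin 5) k :=
  (sixMat c₂ c₃ a s).submatrix Fin.castSucc Fin.castSucc

theorem matQF_castSucc {S : Type} [CommRing S] {n : ℕ} (A : Matrix (Fin (n + 1)) (Fin (n + 1)) S)
    (x : Fin (n + 1) → S) (hx : x (Fin.last n) = 0) :
    matQF (A.submatrix Fin.castSucc Fin.castSucc) (fun i => x i.castSucc) = matQF A x := by
  simp [matQF, Fin.sum_univ_castSucc, hx]

theorem matPolar_castSucc {S : Type} [CommRing S] {n : ℕ}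
    (A : Matrix (Fin (n + 1)) (Fin (n + 1)) S)
    (x y : Fin (n + 1) → S) (hx : x (Fin.last n) = 0) (hy : y (Fin.last n) = 0) :
    matPolar (A.submatrix Fin.castSucc Fin.castSucc) (fun i => x i.castSucc)
      (fun i => y i.castSucc) = matPolar A x y := by
  simp [matPolar, Fin.sum_univ_castSucc, hx, hy]

theorem matAniso_castSucc {S : Type} [CommRing S] {n : ℕ}
    {A : Matrix (Fin (n + 1)) (Fin (n + 1)) S}
    (hA : MatAniso A) : MatAniso (A.submatrix Fin.castSucc Fin.castSucc) := by
  intro x hx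
  have := hA (Fin.snoc x 0) (by
    rw [← matQF_castSucc A _ (by simp)]
    simpa using hx)
  funext i
  simpa using congrFun this i.castSucc

theorem matQF_fiveMat (c₂ c₃ a s : k) (x : Fin 5 → k) :
    matQF (fiveMat c₂ c₃ a s) x = x 0 ^ 2 + c₂ * x 1 ^ 2 + c₃ * x 2 ^ 2 + c₂ * c₃ * x 3 ^ 2 +
      a * x 4 ^ 2 + s * (x 3 * x 4) := by
  have h5 := matQF_castSucc (sevenMat c₂ c₃ a s) ![x 0, x 1, x 2, x 3, x 4, 0, 0] rfl
  have h6 := matQF_castSucc (sixMat c₂ c₃ a s) ![x 0, x 1, x 2, x 3, x 4, 0] rfl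
  have e6 : (fun i : Fin 5 => ![x 0, x 1, x 2, x 3, x 4, 0] i.castSucc) = x := by
    funext i; fin_cases i <;> rfl
  have e5 : (fun i : Fin 6 => ![x 0, x 1, x 2, x 3, x 4, 0, 0] i.castSucc) =
      ![x 0, x 1, x 2, x 3, x 4, 0] := by
    funext i; fin_cases i <;> rfl
  rw [e6] at h6
  rw [e5] at h5
  refine h6.trans (h5.trans ?_)
  rw [matQF_sevenMat]
  simp

theorem exists_representation_sevenMat [CharP k 2] {k₁ k₂ k₃ : Type} [Field k₁] [CharP k₁ 2]
    [Field k₂] [CharP k₂ 2] [Field k₃] {d₁ : k →+* k₁} {d₂ : k₁ →+* k₂} {d₃ : k₂ →+* k₃}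
    {x : k₁} {z : k₂} {w : k₃} (h₁ : IsRationalExtension d₁ x) (h₂ : IsRationalExtension d₂ z)
    (h₃ : IsRationalExtension d₃ w) {c₂ c₃ a s η f₀ : k} (hs : s ≠ 0)
    (hP : MatAniso (sevenMat c₂ c₃ a s)) (p : Fin 7 → k₃)
    (hp : matQF ((((sevenMat c₂ c₃ a s).map d₁).map d₂).map d₃) p =
      d₃ (d₂ (d₁ f₀ + d₁ η * x + d₁ a * x ^ 2) + d₂ (d₁ c₃) * z ^ 2) +
        d₃ (d₂ (d₁ c₂)) * w ^ 2) :
    ∃ p₀ p₁ : Fin 5 → k, matQF (fiveMat c₂ c₃ a s) p₀ = f₀ ∧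
      matPolar (fiveMat c₂ c₃ a s) p₀ p₁ = η ∧ matQF (fiveMat c₂ c₃ a s) p₁ = a := by
  obtain ⟨q, hq, hqs⟩ := h₃.exists_representation_orthogonal
    (h₂.matAniso (h₁.matAniso hP)) ![0, 1, 0, 0, 0, 0, 0]
    (d₂ (d₁ f₀ + d₁ η * x + d₁ a * x ^ 2) + d₂ (d₁ c₃) * z ^ 2) p (by
      rw [hp, sevenMat_map, sevenMat_map, matQF_sevenMat ]
      simp)
  have hq6 : q (Fin.last 6) = 0 := by
    rw [sevenMat_map, sevenMat_map, matPolar_sevenMat] at hqs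
    simpa [hs] using hqs
  rw [← matQF_castSucc _ q hq6] at hq
  obtain ⟨q', hq', hqs'⟩ := h₂.exists_representation_orthogonal
    (h₁.matAniso (matAniso_castSucc hP)) ![0, 0, 1, 0, 0, 0]
    (d₁ f₀ + d₁ η * x + d₁ a * x ^ 2) (fun i => q i.castSucc) (by
      rw [show (((sevenMat c₂ c₃ a s).submatrix (Fin.castSucc (n := 6)) Fin.castSucc).map
        d₁).map d₂ = (((sevenMat c₂ c₃ a s).map d₁).map d₂).submatrix
          Fin.castSucc Fin.castSucc from rfl, hq]
      congr 3
      rw [show ((sevenMat c₂ c₃ a s).submatrix (Fin.castSucc (n := 6)) Fin.castSucc).map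
        d₁ = ((sevenMat c₂ c₃ a s).map d₁).submatrix
          Fin.castSucc Fin.castSucc from rfl]
      have := matQF_castSucc ((sevenMat c₂ c₃ a s).map d₁) ![0, 0, 1, 0, 0, 0, 0] rfl
      rw [sevenMat_map, matQF_sevenMat] at this
      rw [sevenMat_map]
      refine Eq.trans ?_ ((congrArg _ ?_).trans this).symm
      · simp
      · funext i; fin_cases i <;> rfl)
  have hq5 : q' (Fin.last 5) = 0 := by
    have := matPolar_castSucc ((sevenMat c₂ c₃ a s).map d₁)
      ![q' 0, q' 1, q' 2, q' 3, q' 4, q' 5, 0] ![0, 0, 1, 0, 0, 0, 0] rfl rfl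
    rw [sevenMat_map, matPolar_sevenMat, ← sevenMat_map] at this
    have e1 : (fun i : Fin 6 => ![q' 0, q' 1, q' 2, q' 3, q' 4, q' 5, 0] i.castSucc) = q' := by
      funext i; fin_cases i <;> rfl
    have e2 : (fun i : Fin 6 => (![0, 0, 1, 0, 0, 0, 0] : Fin 7 → k₁) i.castSucc) =
        ![0, 0, 1, 0, 0, 0] := by
      funext i; fin_cases i <;> rfl
    rw [e1, e2] at this
    have := this.symm.trans hqs'
    simpa [hs] using this
  rw [← matQF_castSucc _ q' hq5] at hq'
  exact h₁.exists_linear_representation _ (matAniso_castSucc (matAniso_castSucc hP)) f₀ η a _ hq'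

end Descent

section SquareField

variable {F : Type} [Field F] [CharP F 2]

/-- The totally singular form `⟨1, c₂, c₃, c₂c₃⟩`, an additive map in characteristic two. -/
def sqForm (c₂ c₃ : F) : (Fin 4 → F) →+ F where
  toFun k := k 0 ^ 2 + c₂ * k 1 ^ 2 + c₃ * k 2 ^ 2 + c₂ * c₃ * k 3 ^ 2
  map_zero' := by simp
  map_add' x y := by simp only [Pi.add_apply, CharTwo.add_sq]; ring

theorem sqForm_apply (c₂ c₃ : F) (k : Fin 4 → F) :
    sqForm c₂ c₃ k = k 0 ^ 2 + c₂ * k 1 ^ 2 + c₃ * k 2 ^ 2 + c₂ * c₃ * k 3 ^ 2 := rfl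

theorem sqForm_smul (c₂ c₃ r : F) (k : Fin 4 → F) :
    sqForm c₂ c₃ (r • k) = r ^ 2 * sqForm c₂ c₃ k := by
  simp only [sqForm_apply, Pi.smul_apply, smul_eq_mul]; ring

/-- The subfield `F²(c₂,c₃)` of `F`. -/
def sqField (c₂ c₃ : F) : Subfield F where
  carrier := Set.range (sqForm c₂ c₃)
  zero_mem' := ⟨0, map_zero _⟩
  one_mem' := ⟨![1, 0, 0, 0], by simp [sqForm_apply]⟩
  add_mem' := by rintro _ _ ⟨x, rfl⟩ ⟨y, rfl⟩; exact ⟨x + y, map_add _ _ _⟩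
  neg_mem' := by rintro _ ⟨x, rfl⟩; exact ⟨-x, map_neg _ _⟩
  mul_mem' := by
    rintro _ _ ⟨x, rfl⟩ ⟨y, rfl⟩
    refine ⟨![x 0 * y 0 + c₂ * (x 1 * y 1) + c₃ * (x 2 * y 2) + c₂ * c₃ * (x 3 * y 3),
      x 0 * y 1 + x 1 * y 0 + c₃ * (x 2 * y 3 + x 3 * y 2),
      x 0 * y 2 + x 2 * y 0 + c₂ * (x 1 * y 3 + x 3 * y 1),
      x 0 * y 3 + x 3 * y 0 + x 1 * y 2 + x 2 * y 1], ?_⟩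
    simp [sqForm_apply, CharTwo.add_sq, mul_pow]
    ring
  inv_mem' := by
    rintro _ ⟨x, rfl⟩
    refine ⟨(sqForm c₂ c₃ x)⁻¹ • x, ?_⟩
    rw [sqForm_smul]
    by_cases h : sqForm c₂ c₃ x = 0
    · simp [h]
    · field_simp

theorem mem_sqField {c₂ c₃ d : F} : d ∈ sqField c₂ c₃ ↔ ∃ k, sqForm c₂ c₃ k = d := Iff.rfl

theorem sq_mem_sqField (c₂ c₃ x : F) : x ^ 2 ∈ sqField c₂ c₃ :=
  mem_sqField.2 ⟨![x, 0, 0, 0], by simp [sqForm_apply]⟩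

theorem left_mem_sqField (c₂ c₃ : F) : c₂ ∈ sqField c₂ c₃ :=
  mem_sqField.2 ⟨![0, 1, 0, 0], by simp [sqForm_apply]⟩

theorem right_mem_sqField (c₂ c₃ : F) : c₃ ∈ sqField c₂ c₃ :=
  mem_sqField.2 ⟨![0, 0, 1, 0], by simp [sqForm_apply]⟩

/-- The Frobenius map, seen as an embedding of `F` into `F²(c₂,c₃)`. -/
def sqEmb (c₂ c₃ : F) : F →+* sqField c₂ c₃ :=
  (frobenius F 2).codRestrict (sqField c₂ c₃) fun x => by
    rw [frobenius_def]; exact sq_mem_sqField c₂ c₃ x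

/-- Anisotropy of `[a,b] ⊥ ⟨1, c₂, c₃, c₂c₃⟩`. -/
def SqAniso (a b c₂ c₃ : F) : Prop :=
  ∀ x y k, a * x ^ 2 + x * y + b * y ^ 2 + sqForm c₂ c₃ k = 0 → x = 0 ∧ y = 0 ∧ k = 0

variable {a b c₂ c₃ : F}

theorem SqAniso.notMem (h : SqAniso a b c₂ c₃) : a ∉ sqField c₂ c₃ := by
  intro ha
  obtain ⟨k, hk⟩ := mem_sqField.1 ha
  have := (h 1 0 k (by rw [hk]; simp [CharTwo.add_self_eq_zero])).1
  exact one_ne_zero this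

theorem SqAniso.eq_zero_of_sqForm (h : SqAniso a b c₂ c₃) {k : Fin 4 → F}
    (hk : sqForm c₂ c₃ k = 0) : k = 0 :=
  (h 0 0 k (by simp [hk])).2.2

instance sqField_charP (c₂ c₃ : F) : CharP (sqField c₂ c₃) 2 :=
  (RingHom.charP_iff _ (sqField c₂ c₃).subtype.injective 2).2 inferInstance

theorem SqAniso.matAniso_binOneMat (h : SqAniso a b c₂ c₃) :
    MatAniso (binOneMat (sqEmb c₂ c₃ a) (sqEmb c₂ c₃ b)) := by
  intro v hv
  rw [matQF_binOneMat] at hv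
  have hch : (2 : F) = 0 := CharTwo.two_eq_zero
  obtain ⟨⟨x, hx⟩, hX⟩ : ∃ x, v 0 = x := ⟨_, rfl⟩
  obtain ⟨⟨y, hy⟩, hY⟩ : ∃ y, v 1 = y := ⟨_, rfl⟩
  obtain ⟨⟨u, hu⟩, hU⟩ : ∃ u, v 2 = u := ⟨_, rfl⟩
  rw [hX, hY, hU] at hv
  have hv' : a ^ 2 * x ^ 2 + x * y + b ^ 2 * y ^ 2 + u ^ 2 = 0 := congrArg Subtype.val hv
  have hy0 : y = 0 := by
    by_contra hy0
    obtain ⟨k, hk⟩ := mem_sqField.1 (div_mem hu hy)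
    set m := a * x + b * y + u with hm
    have hm2 : m ^ 2 = x * y := by
      rw [hm, CharTwo.add_sq, CharTwo.add_sq]; linear_combination hv' - x * y * hch
    refine one_ne_zero (h (m / y) 1 k ?_).2.1
    rw [hk]
    have : (a * (m / y) ^ 2 + m / y * 1 + b * 1 ^ 2 + u / y) ^ 2 = 0 := by
      rw [div_pow, hm2]
      field_simp
      simp only [CharTwo.add_sq, mul_pow, hm2]
      linear_combination hv'
    exact pow_eq_zero_iff two_ne_zero |>.1 this
  subst hy0
  have hx0 : x = 0 := by
    by_contra hx0
    apply h.notMem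
    have : a = u / x := by
      field_simp
      have : (a * x + u) ^ 2 = 0 := by rw [CharTwo.add_sq]; linear_combination hv'
      have := pow_eq_zero_iff two_ne_zero |>.1 this
      linear_combination this - u * hch
    rw [this]
    exact div_mem hu hx
  subst hx0
  have hu0 : u = 0 := by simpa using hv'
  subst hu0
  funext i
  fin_cases i
  · exact hX
  · exact hY
  · exact hU

/-- A similarity between `[a,b] ⊥ ⟨1,c₂,c₃,c₂c₃⟩` and a form with quasilinear part in
`F²(c₂,c₃)`, recorded by the values on two basis vectors of the nonsingular part. -/
theorem exists_common_factor {κ₀ κ₁ e f α β γ δ : F}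
    (h1 : a ^ 2 * α ^ 2 + α * γ + b ^ 2 * γ ^ 2 + κ₁ ^ 2 = e ^ 2)
    (h0 : a ^ 2 * β ^ 2 + β * δ + b ^ 2 * δ ^ 2 + κ₀ ^ 2 = f ^ 2)
    (h01 : α * δ + β * γ = 1) :
    ∃ ρ A₁ A₂ B₁ B₂ : F, (ρ = α ∨ ρ = γ) ∧ ρ ≠ 0 ∧ α = ρ * A₁ ^ 2 ∧ γ = ρ * A₂ ^ 2 ∧
      β = ρ * B₁ ^ 2 ∧ δ = ρ * B₂ ^ 2 := by
  have hch : (2 : F) = 0 := CharTwo.two_eq_zero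
  obtain ⟨r, hr⟩ : ∃ r, r ^ 2 = α * γ := ⟨a * α + b * γ + κ₁ + e, by
    simp only [CharTwo.add_sq, mul_pow]; linear_combination h1 + (e ^ 2 - α * γ) * hch⟩
  obtain ⟨s, hs⟩ : ∃ s, s ^ 2 = β * δ := ⟨a * β + b * δ + κ₀ + f, by
    simp only [CharTwo.add_sq, mul_pow]; linear_combination h0 + (f ^ 2 - β * δ) * hch⟩
  by_cases hα : α = 0
  · have hγ : γ ≠ 0 := by rintro rfl; simp [hα] at h01
    refine ⟨γ, 0, 1, 1 / γ, (r * δ + s * γ) / γ, Or.inr rfl, hγ, by simp [hα], by simp, ?_, ?_⟩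
    · field_simp; rw [← h01, hα]; ring
    · field_simp
      rw [CharTwo.add_sq, mul_pow, mul_pow, hr, hs]
      linear_combination - δ * γ * h01
  · refine ⟨α, 1, r / α, (α * s + β * r) / α, (α * δ + r * s) / α, Or.inl rfl, hα, by simp, ?_,
      ?_, ?_⟩
    · field_simp; rw [hr, mul_comm]
    · field_simp
      rw [CharTwo.add_sq, mul_pow, mul_pow, hr, hs]
      linear_combination - α * β * h01
    · field_simp
      rw [CharTwo.add_sq, mul_pow, mul_pow, hr, hs]
      linear_combination - α * δ * h01

/-- The form `[e,f] ⊥ ⟨1, d₁, …, d_m⟩`. -/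
def normalForm {m : ℕ} (e f : F) (d : Fin m → F) (x : Option (Fin 2 ⊕ Fin m) → F) : F :=
  e * x (some (.inl 0)) ^ 2 + x (some (.inl 0)) * x (some (.inl 1)) +
    f * x (some (.inl 1)) ^ 2 + x none ^ 2 + ∑ j, d j * x (some (.inr j)) ^ 2

theorem exists_similarity {m : ℕ} {d : Fin m → F} {κ₀ κ₁ e f α β γ δ : F}
    (hd : ∀ j, d j ∈ sqField c₂ c₃) (hκ₀ : κ₀ ∈ sqField c₂ c₃) (hκ₁ : κ₁ ∈ sqField c₂ c₃)
    (hα : α ∈ sqField c₂ c₃) (hγ : γ ∈ sqField c₂ c₃)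
    (h1 : a ^ 2 * α ^ 2 + α * γ + b ^ 2 * γ ^ 2 + κ₁ ^ 2 = e ^ 2)
    (h0 : a ^ 2 * β ^ 2 + β * δ + b ^ 2 * δ ^ 2 + κ₀ ^ 2 = f ^ 2)
    (h01 : α * δ + β * γ = 1) :
    ∃ ρ : F, ρ ≠ 0 ∧ ∃ Θ : (Option (Fin 2 ⊕ Fin m) → F) →ₗ[F] (Option (Fin 2 ⊕ Fin 3) → F),
      ∀ x, ρ * normalForm a b ![c₂, c₃, c₂ * c₃] (Θ x) = normalForm e f d x := by
  have hch : (2 : F) = 0 := CharTwo.two_eq_zero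
  obtain ⟨ρ, A₁, A₂, B₁, B₂, hρ, hρ0, eα, eγ, eβ, eδ⟩ := exists_common_factor h1 h0 h01
  have hρL : ρ⁻¹ ∈ sqField c₂ c₃ := inv_mem (by rcases hρ with rfl | rfl <;> assumption)
  obtain ⟨s, hs⟩ := mem_sqField.1 hρL
  obtain ⟨s₀, hs₀⟩ := mem_sqField.1 (mul_mem hρL hκ₀)
  obtain ⟨s₁, hs₁⟩ := mem_sqField.1 (mul_mem hρL hκ₁)
  have hd' : ∀ j, ∃ k, sqForm c₂ c₃ k = ρ⁻¹ * d j := fun j => mem_sqField.1 (mul_mem hρL (hd j))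
  choose t ht using hd'
  let pr (i : Option (Fin 2 ⊕ Fin m)) : (Option (Fin 2 ⊕ Fin m) → F) →ₗ[F] F := LinearMap.proj i
  let K : (Option (Fin 2 ⊕ Fin m) → F) →ₗ[F] (Fin 4 → F) :=
    (pr none).smulRight s + (pr (some (.inl 0))).smulRight s₁ +
      (pr (some (.inl 1))).smulRight s₀ + ∑ j, (pr (some (.inr j))).smulRight (t j)
  have hK : ∀ x, ρ * sqForm c₂ c₃ (K x) = x none ^ 2 + κ₁ * x (some (.inl 0)) ^ 2 +
      κ₀ * x (some (.inl 1)) ^ 2 + ∑ j, d j * x (some (.inr j)) ^ 2 := by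
    intro x
    have : K x = x none • s + x (some (.inl 0)) • s₁ + x (some (.inl 1)) • s₀ +
      ∑ j, x (some (.inr j)) • t j := by simp [K, pr]
    rw [this, map_add, map_add, map_add, map_sum]
    simp only [sqForm_smul, hs, hs₀, hs₁, ht, mul_add, Finset.mul_sum]
    congr 1
    · field_simp
    · refine Finset.sum_congr rfl fun j _ => ?_
      field_simp
  refine ⟨ρ, hρ0, LinearMap.pi fun i => match i with
    | none => (LinearMap.proj 0).comp K
    | some (.inl 0) => A₁ • pr (some (.inl 0)) + B₁ • pr (some (.inl 1))
    | some (.inl 1) => A₂ • pr (some (.inl 0)) + B₂ • pr (some (.inl 1))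
    | some (.inr j) => (LinearMap.proj j.succ).comp K, fun x => ?_⟩
  have hKx := hK x
  rw [sqForm_apply] at hKx
  simp only [normalForm, LinearMap.pi_apply, Fin.sum_univ_three]
  simp [pr]
  set X := x (some (.inl 0))
  set Y := x (some (.inl 1))
  set S := ∑ j, d j * x (some (.inr j)) ^ 2
  set Z := x none
  set k := K x
  set P := A₁ * X + B₁ * Y with hP
  set Q := A₂ * X + B₂ * Y with hQ
  have hP2 : α * X ^ 2 + β * Y ^ 2 = ρ * P ^ 2 := by
    rw [hP, CharTwo.add_sq, eα, eβ]; ring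
  have hQ2 : γ * X ^ 2 + δ * Y ^ 2 = ρ * Q ^ 2 := by
    rw [hQ, CharTwo.add_sq, eγ, eδ]; ring
  have hsq : (ρ * (a * P ^ 2 + P * Q + b * Q ^ 2) + (Z ^ 2 + κ₁ * X ^ 2 + κ₀ * Y ^ 2 + S) +
      (e * X ^ 2 + X * Y + f * Y ^ 2 + Z ^ 2 + S)) ^ 2 = 0 := by
    have : (ρ * (a * P ^ 2 + P * Q + b * Q ^ 2)) ^ 2 = a ^ 2 * (α * X ^ 2 + β * Y ^ 2) ^ 2 +
        (α * X ^ 2 + β * Y ^ 2) * (γ * X ^ 2 + δ * Y ^ 2) +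
        b ^ 2 * (γ * X ^ 2 + δ * Y ^ 2) ^ 2 := by
      rw [hP2, hQ2]; simp only [mul_pow, CharTwo.add_sq]; ring
    simp only [CharTwo.add_sq, this]
    linear_combination X ^ 4 * h1 + Y ^ 4 * h0 + X ^ 2 * Y ^ 2 * h01 +
      (e ^ 2 * X ^ 4 + f ^ 2 * Y ^ 4 + X ^ 2 * Y ^ 2 + Z ^ 4 + S ^ 2) * hch
  have := pow_eq_zero_iff two_ne_zero |>.1 hsq
  linear_combination this + hKx - (e * X ^ 2 + X * Y + f * Y ^ 2 + Z ^ 2 + S) * hch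

end SquareField

section Specialization

variable {F k E σ : Type} [Field F] [Field k] [Field E]

/-- Every polynomial vanishing at the point `g` over the extension also vanishes at the
`F`-rational point `ζ`. -/
def SpecializesTo (c : F →+* k) (g : σ → k) (ζ : σ → F) : Prop :=
  ∀ p : MvPolynomial σ F, eval₂ c g p = 0 → eval ζ p = 0

theorem specializesTo_base (c : F →+* k) (ζ : σ → F) : SpecializesTo c (fun i => c (ζ i)) ζ := by
  intro p hp
  apply c.injective
  rw [map_zero, ← hp, ← eval₂_id, MvPolynomial.eval₂_comp_left c]
  rfl

theorem SpecializesTo.extend {c : F →+* k} {g : σ → k} {ζ : σ → F} (h : SpecializesTo c g ζ)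
    {c' : k →+* E} {t : E} (hc : IsRationalExtension c' t) {g' : σ → E} (i : σ) (hi : g' i = t)
    (hj : ∀ j, j ≠ i → g' j = c' (g j)) : SpecializesTo (c'.comp c) g' ζ := by
  classical
  intro p hp
  apply h
  set G : σ → Polynomial k := fun j => if j = i then Polynomial.X else Polynomial.C (g j) with hG
  have h1 : Polynomial.eval₂RingHom c' t (eval₂ (Polynomial.C.comp c) G p) = 0 := by
    rw [MvPolynomial.eval₂_comp_left, ← hp]
    congr 1
    · ext x; simp
    · funext j
      by_cases hij : j = i
      · subst hij; simp [hG, hi]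
      · simp [hG, hij, hj j hij]
  have h2 := congrArg (Polynomial.evalRingHom (g i)) (hc.transcendental _ h1)
  rw [MvPolynomial.eval₂_comp_left, map_zero] at h2
  rw [← h2]
  congr 1
  · ext x; simp
  · funext j
    by_cases hij : j = i
    · subst hij; simp [hG]
    · simp [hG, hij]

end Specialization

/-- The value of the diagonal form `⟨1, c₂, c₃⟩`. -/
def triForm {S : Type} [CommRing S] (c₂ c₃ : S) (u : Fin 3 → S) : S :=
  u 0 ^ 2 + c₂ * u 1 ^ 2 + c₃ * u 2 ^ 2

theorem map_triForm {S T : Type} [CommRing S] [CommRing T] (f : S →+* T) (c₂ c₃ : S)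
    (u : Fin 3 → S) : f (triForm c₂ c₃ u) = triForm (f c₂) (f c₃) (fun i => f (u i)) := by
  simp [triForm]

theorem exists_binOneMat_representation {E : Type} [Field E] [CharP E 2] {a b c₂ c₃ r₂ r₃ X Y δ : E}
    {u v : Fin 3 → E} (h₂ : r₂ ^ 2 = c₂) (h₃ : r₃ ^ 2 = c₃) (hv : triForm c₂ c₃ v ≠ 0)
    (h : a * X ^ 2 + X * Y + b * Y ^ 2 = triForm c₂ c₃ u + δ * triForm c₂ c₃ v) :
    ∃ p, matQF (binOneMat a b) p = δ := by
  have hch : (2 : E) = 0 := CharTwo.two_eq_zero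
  have hsq : ∀ w : Fin 3 → E, triForm c₂ c₃ w = (w 0 + r₂ * w 1 + r₃ * w 2) ^ 2 := by
    intro w
    rw [triForm, CharTwo.add_sq, CharTwo.add_sq, mul_pow, mul_pow, h₂, h₃]
  have h0 : v 0 + r₂ * v 1 + r₃ * v 2 ≠ 0 := fun h0 => hv (by rw [hsq, h0]; simp)
  rw [hsq, hsq] at h
  set w := v 0 + r₂ * v 1 + r₃ * v 2
  set z := u 0 + r₂ * u 1 + r₃ * u 2
  refine ⟨![X / w, Y / w, z / w], ?_⟩
  rw [matQF_binOneMat]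
  simp
  field_simp
  linear_combination h + z ^ 2 * hch

section Core

variable {F : Type} [Field F] [CharP F 2] {a b c₂ c₃ : F}

theorem SqAniso.infinite (h : SqAniso a b c₂ c₃) : Infinite F := by
  by_contra hfin
  rw [not_infinite_iff_finite] at hfin
  obtain ⟨r, hr⟩ := (Finite.injective_iff_surjective.1 (frobenius_inj F 2)) c₂
  rw [frobenius_def] at hr
  have := h.eq_zero_of_sqForm (k := ![r, 1, 0, 0]) (by
    simp [sqForm_apply, hr, CharTwo.add_self_eq_zero])
  simpa using congrFun this 1

theorem SqAniso.eq_zero_of_triForm (h : SqAniso a b c₂ c₃) {u : Fin 3 → F}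
    (hu : triForm c₂ c₃ u = 0) : u = 0 := by
  have := h.eq_zero_of_sqForm (k := ![u 0, u 1, u 2, 0]) (by
    simpa [sqForm_apply, triForm] using hu)
  funext i
  fin_cases i
  · exact congrFun this 0
  · exact congrFun this 1
  · exact congrFun this 2

/-- The generic value of `[e,f] ⊥ ⟨d₁, …, d_m⟩`. -/
noncomputable def innerPoly {m : ℕ} (e f : F) (d : Fin m → F) : MvPolynomial (Fin 2 ⊕ Fin m) F :=
  C e * X (.inl 0) ^ 2 + X (.inl 0) * X (.inl 1) + C f * X (.inl 1) ^ 2 +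
    ∑ j, C (d j) * X (.inr j) ^ 2

/-- A representation of `δ` by `[a,b] ⊥ ⟨1,c₂,c₃⟩` over the function field of its quadric,
cleared of denominators. -/
def HasCoreEquation {σ : Type} (a b c₂ c₃ : F) (δ : MvPolynomial σ F) : Prop :=
  ∃ (x y : MvPolynomial σ F) (u v : Fin 3 → MvPolynomial σ F), v ≠ 0 ∧
    C a * x ^ 2 + x * y + C b * y ^ 2 =
      triForm (C c₂) (C c₃) u + δ * triForm (C c₂) (C c₃) v

theorem exists_good_point (h : SqAniso a b c₂ c₃) {σ : Type} (i : σ)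
    {v : Fin 3 → MvPolynomial σ F} (hv : v ≠ 0) :
    ∃ ζ : σ → F, ζ i ≠ 0 ∧ eval ζ (triForm (C c₂) (C c₃) v) ≠ 0 := by
  have := h.infinite
  obtain ⟨j, hj⟩ := Function.ne_iff.1 hv
  obtain ⟨ζ, hζ⟩ : ∃ ζ : σ → F, eval ζ (X i * v j) ≠ 0 := by
    by_contra hcon
    push Not at hcon
    exact mul_ne_zero (X_ne_zero i) hj (MvPolynomial.funext fun ζ => by simpa using hcon ζ)
  simp only [map_mul, eval_X, mul_ne_zero_iff] at hζ
  refine ⟨ζ, hζ.1, fun h0 => hζ.2 ?_⟩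
  rw [map_triForm, eval_C, eval_C] at h0
  exact congrFun (h.eq_zero_of_triForm h0) j

theorem HasCoreEquation.exists_representation {σ : Type} {δ : MvPolynomial σ F}
    {x y : MvPolynomial σ F} {u v : Fin 3 → MvPolynomial σ F}
    (heq : C a * x ^ 2 + x * y + C b * y ^ 2 =
      triForm (C c₂) (C c₃) u + δ * triForm (C c₂) (C c₃) v) {ζ : σ → F}
    (hζ : eval ζ (triForm (C c₂) (C c₃) v) ≠ 0) {E : Type} [Field E] [CharP E 2]
    (j : sqField c₂ c₃ →+* E) {g : σ → E} (hg : SpecializesTo (j.comp (sqEmb c₂ c₃)) g ζ) :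
    ∃ p, matQF (binOneMat (j (sqEmb c₂ c₃ a)) (j (sqEmb c₂ c₃ b))) p =
      eval₂ (j.comp (sqEmb c₂ c₃)) g δ := by
  have h := congrArg (eval₂Hom (j.comp (sqEmb c₂ c₃)) g) heq
  have hv : eval₂Hom (j.comp (sqEmb c₂ c₃)) g (triForm (C c₂) (C c₃) v) ≠ 0 := fun h0 =>
    hζ (hg _ h0)
  simp only [map_add, map_mul, map_pow, map_triForm] at h hv
  simp only [coe_eval₂Hom, eval₂_C, RingHom.comp_apply] at h hv
  refine exists_binOneMat_representation (r₂ := j ⟨c₂, left_mem_sqField c₂ c₃⟩)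
    (r₃ := j ⟨c₃, right_mem_sqField c₂ c₃⟩) ?_ ?_ hv h
  · rw [← map_pow]; rfl
  · rw [← map_pow]; rfl

theorem HasCoreEquation.mem_sqField (h : SqAniso a b c₂ c₃) {m : ℕ} {e f : F} {d : Fin m → F}
    (hcore : HasCoreEquation a b c₂ c₃ (innerPoly e f d)) (j : Fin m) : d j ∈ sqField c₂ c₃ := by
  classical
  obtain ⟨x, y, u, v, hv, heq⟩ := hcore
  obtain ⟨ζ, hζ1, hζ⟩ := exists_good_point h (.inl 1) hv
  obtain ⟨k₁, _, _, c, s, hc⟩ := exists_isRationalExtension (sqField c₂ c₃)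
  obtain ⟨k₂, _, _, c', t, hc'⟩ := exists_isRationalExtension k₁
  set ι := sqEmb c₂ c₃ with hι
  set g₁ : Fin 2 ⊕ Fin m → k₁ := fun i => if i = .inl 0 then s else c (ι (ζ i)) with hg₁
  set g₂ : Fin 2 ⊕ Fin m → k₂ := fun i => if i = .inr j then t else c' (g₁ i) with hg₂
  have hS₁ : SpecializesTo (c.comp ι) g₁ ζ := (specializesTo_base ι ζ).extend hc (.inl 0)
    (by simp [hg₁]) (fun i hi => by simp [hg₁, hi])
  have hS₂ : SpecializesTo (c'.comp (c.comp ι)) g₂ ζ := hS₁.extend hc' (.inr j)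
    (by simp [hg₂]) (fun i hi => by simp [hg₂, hi])
  obtain ⟨p, hp⟩ := exists_representation heq hζ (c'.comp c) (g := g₂) hS₂
  obtain ⟨r, hr⟩ := exists_sq_eq_of_representation hc hc' (d := ι (d j)) (e := ι e)
    (η := ι (ζ (.inl 1))) (g := ι (f * ζ (.inl 1) ^ 2 +
      ∑ i ∈ Finset.univ.erase j, d i * ζ (.inr i) ^ 2)) h.matAniso_binOneMat
    (by simpa using hζ1) p (by
      rw [binOneMat_map, binOneMat_map]
      refine hp.trans ?_
      have hsum : ∑ i, (c' (c (ι (d i)))) * g₂ (.inr i) ^ 2 = c' (c (ι (d j))) * t ^ 2 +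
          ∑ i ∈ Finset.univ.erase j, c' (c (ι (d i))) * c' (c (ι (ζ (.inr i)))) ^ 2 := by
        rw [← Finset.add_sum_erase _ _ (Finset.mem_univ j)]
        congr 1
        · simp [hg₂]
        · refine Finset.sum_congr rfl fun i hi => ?_
          simp [hg₂, hg₁, Finset.ne_of_mem_erase hi]
      simp only [innerPoly, eval₂_add, eval₂_mul, eval₂_C, eval₂_X, eval₂_pow, eval₂_sum,
        RingHom.comp_apply]
      rw [← hι, hsum]
      simp [hg₂, hg₁]
      ring)
  have := congrArg Subtype.val hr
  rw [hι] at this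
  have h2 : ((r : F) + d j) ^ 2 = 0 := by
    rw [CharTwo.add_sq]
    have e1 : (r : F) ^ 2 = d j ^ 2 := this
    rw [e1, CharTwo.add_self_eq_zero]
  rw [← CharTwo.add_eq_zero.1 (pow_eq_zero_iff two_ne_zero |>.1 h2)]
  exact r.2

theorem HasCoreEquation.exists_similarity (h : SqAniso a b c₂ c₃) {m : ℕ} {e f : F}
    {d : Fin m → F} (hcore : HasCoreEquation a b c₂ c₃ (innerPoly e f d)) :
    ∃ ρ : F, ρ ≠ 0 ∧ ∃ Θ : (Option (Fin 2 ⊕ Fin m) → F) →ₗ[F] (Option (Fin 2 ⊕ Fin 3) → F),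
      ∀ x, ρ * normalForm a b ![c₂, c₃, c₂ * c₃] (Θ x) = normalForm e f d x := by
  classical
  have hd := hcore.mem_sqField h
  obtain ⟨x, y, u, v, hv, heq⟩ := hcore
  obtain ⟨ζ, hζ1, hζ⟩ := exists_good_point h (.inl 1) hv
  obtain ⟨k₁, _, _, c, s, hc⟩ := exists_isRationalExtension (sqField c₂ c₃)
  set ι := sqEmb c₂ c₃ with hι
  set g₁ : Fin 2 ⊕ Fin m → k₁ := fun i => if i = .inl 0 then s else c (ι (ζ i)) with hg₁
  have hS₁ : SpecializesTo (c.comp ι) g₁ ζ := (specializesTo_base ι ζ).extend hc (.inl 0)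
    (by simp [hg₁]) (fun i hi => by simp [hg₁, hi])
  obtain ⟨p, hp⟩ := exists_representation heq hζ c (g := g₁) hS₁
  set w : sqField c₂ c₃ := ∑ j, (⟨d j, hd j⟩ : sqField c₂ c₃) * ι (ζ (.inr j)) with hw
  have hw2 : w ^ 2 = ∑ j, ι (d j) * ι (ζ (.inr j)) ^ 2 := by
    rw [hw, sum_pow_char 2]
    refine Finset.sum_congr rfl fun j _ => ?_
    rw [mul_pow]
    rfl
  have hch : (2 : k₁) = 0 := CharTwo.two_eq_zero
  obtain ⟨p₀, p₁, h0, h01, h1⟩ := hc.exists_linear_representation _ h.matAniso_binOneMat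
    (ι (f * ζ (.inl 1) ^ 2)) (ι (ζ (.inl 1))) (ι e) ![p 0, p 1, p 2 + c w] (by
      rw [binOneMat_map]
      rw [matQF_binOneMat] at hp ⊢
      simp only [innerPoly, eval₂_add, eval₂_mul, eval₂_C, eval₂_X, eval₂_pow, eval₂_sum,
        RingHom.comp_apply] at hp
      have hsum : ∑ j, c (ι (d j)) * g₁ (.inr j) ^ 2 = c w ^ 2 := by
        rw [← map_pow, hw2]
        simp [hg₁]
      rw [← hι, hsum] at hp
      simp [hg₁] at hp ⊢
      rw [CharTwo.add_sq]
      linear_combination hp + c w ^ 2 * hch)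
  rw [matQF_binOneMat] at h0 h1
  rw [matPolar_binOneMat] at h01
  set η := ι (ζ (.inl 1)) with hη
  have hη0 : η ≠ 0 := by simpa [hη] using hζ1
  refine _root_.exists_similarity (a := a) (b := b) (κ₀ := ((p₀ 2 / η : sqField c₂ c₃) : F))
    (κ₁ := ((p₁ 2 : sqField c₂ c₃) : F)) (α := ((p₁ 0 : sqField c₂ c₃) : F))
    (γ := ((p₁ 1 : sqField c₂ c₃) : F)) (β := ((p₀ 0 / η : sqField c₂ c₃) : F))
    (δ := ((p₀ 1 / η : sqField c₂ c₃) : F)) hd (SetLike.coe_mem _)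
    (SetLike.coe_mem _) (SetLike.coe_mem _) (SetLike.coe_mem _) ?_ ?_ ?_
  · exact congrArg Subtype.val h1
  · have : ι a * (p₀ 0 / η) ^ 2 + (p₀ 0 / η) * (p₀ 1 / η) + ι b * (p₀ 1 / η) ^ 2 +
        (p₀ 2 / η) ^ 2 = ι f := by
      rw [map_mul, map_pow] at h0
      field_simp
      linear_combination h0
    exact congrArg Subtype.val this
  · have : p₁ 0 * (p₀ 1 / η) + (p₀ 0 / η) * p₁ 1 = 1 := by
      field_simp
      linear_combination h01
    exact congrArg Subtype.val this

theorem exists_sevenMat_representation {E : Type} [Field E] [CharP E 2]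
    {a b c₂ c₃ η s t x z w X Y : E} {u v : Fin 3 → E} (hη : η ≠ 0) (ht : t ≠ 0) (hst : s * t = η)
    (hA : MatAniso (sevenMat c₂ c₃ a s)) (hv : v ≠ 0)
    (h : a * X ^ 2 + X * Y + b * Y ^ 2 = triForm c₂ c₃ u +
      (a * x ^ 2 + x * η + b * η ^ 2 + (c₂ * w ^ 2 + c₃ * z ^ 2 + c₂ * c₃ * t ^ 2)) *
        triForm c₂ c₃ v) :
    ∃ p, matQF (sevenMat c₂ c₃ a s) p =
      a * x ^ 2 + x * η + b * η ^ 2 + (c₂ * w ^ 2 + c₃ * z ^ 2 + c₂ * c₃ * t ^ 2) := by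
  have hch : (2 : E) = 0 := CharTwo.two_eq_zero
  set δ := a * x ^ 2 + x * η + b * η ^ 2 + (c₂ * w ^ 2 + c₃ * z ^ 2 + c₂ * c₃ * t ^ 2) with hδ
  obtain ⟨G, hG⟩ : ∃ G, G = η * X + x * Y := ⟨_, rfl⟩
  obtain ⟨m₀, hm₀⟩ : ∃ m, m = η * u 0 := ⟨_, rfl⟩
  obtain ⟨m₁, hm₁⟩ : ∃ m, m = η * u 1 + Y * w := ⟨_, rfl⟩
  obtain ⟨m₂, hm₂⟩ : ∃ m, m = η * u 2 + Y * z := ⟨_, rfl⟩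
  obtain ⟨r₀, hr₀⟩ : ∃ r, r = η * v 0 + Y := ⟨_, rfl⟩
  obtain ⟨r₁, hr₁⟩ : ∃ r, r = η * v 1 := ⟨_, rfl⟩
  obtain ⟨r₂, hr₂⟩ : ∃ r, r = η * v 2 := ⟨_, rfl⟩
  have key : m₀ ^ 2 + c₂ * m₁ ^ 2 + c₃ * m₂ ^ 2 + c₂ * c₃ * (Y * t) ^ 2 + a * G ^ 2 +
      s * (Y * t * G) = δ * (r₀ ^ 2 + c₂ * r₁ ^ 2 + c₃ * r₂ ^ 2) := by
    have e1 : s * (Y * t * G) = η * Y * G := by rw [← hst]; ring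
    rw [e1, hG, hm₀, hm₁, hm₂, hr₀, hr₁, hr₂]
    simp only [CharTwo.add_sq, mul_pow]
    simp only [triForm] at h
    linear_combination η ^ 2 * h + (η ^ 2 * (u 0 ^ 2 + c₂ * u 1 ^ 2 + c₃ * u 2 ^ 2) -
      η ^ 2 * Y ^ 2 * b) * hch - Y ^ 2 * hδ
  set N := r₀ ^ 2 + c₂ * r₁ ^ 2 + c₃ * r₂ ^ 2 with hN
  have hN0 : N ≠ 0 := by
    intro hN0
    have hr := hA ![r₀, r₁, r₂, 0, 0, 0, 0] (by rw [matQF_sevenMat]; simpa [hN] using hN0)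
    have h0 : r₀ = 0 := congrFun hr 0
    have h1 : r₁ = 0 := congrFun hr 1
    have h2 : r₂ = 0 := congrFun hr 2
    have hm := hA ![m₀, m₁, m₂, Y * t, G, 0, 0] (by
      rw [matQF_sevenMat]
      simp
      rw [hN0] at key
      linear_combination key)
    have hY : Y * t = 0 := congrFun hm 3
    have hY0 : Y = 0 := (mul_eq_zero.1 hY).resolve_right ht
    apply hv
    funext i
    fin_cases i
    · simpa [hr₀, hY0, hη] using h0
    · simpa [hr₁, hη] using h1
    · simpa [hr₂, hη] using h2
  refine ⟨fun i => N⁻¹ * ![m₀ * r₀ + c₂ * (m₁ * r₁) + c₃ * (m₂ * r₂),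
    m₀ * r₁ + m₁ * r₀ + c₃ * (Y * t * r₂), m₀ * r₂ + m₂ * r₀ + c₂ * (Y * t * r₁),
    Y * t * r₀ + m₁ * r₂ + m₂ * r₁, G * r₀, G * r₁, G * r₂] i, ?_⟩
  rw [matQF_smul, matQF_sevenMat]
  simp
  field_simp
  simp only [CharTwo.add_sq, mul_pow]
  linear_combination N * key + s * G * (m₁ * r₀ * r₂ + m₂ * r₁ * r₀ + m₀ * r₁ * r₂) * hch

theorem matAniso_sevenMat_ratExt (h : SqAniso a b c₂ c₃) {k : Type} [Field k] {c : F →+* k}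
    {t : k} (hc : IsRationalExtension c t) (η : F) :
    MatAniso (sevenMat (c c₂) (c c₃) (c a) (c η / t)) := by
  have hA : MatAniso (sevenMat c₂ c₃ a 0) := by
    intro x hx
    rw [matQF_sevenMat] at hx
    have hx' : sqForm c₂ c₃ ![x 0, x 1, x 2, x 3] + a * sqForm c₂ c₃ ![x 4, x 5, x 6, 0] = 0 := by
      simp [sqForm_apply]
      linear_combination hx
    have h2 : sqForm c₂ c₃ ![x 4, x 5, x 6, 0] = 0 := by
      by_contra hne
      apply h.notMem
      have : a = sqForm c₂ c₃ ![x 0, x 1, x 2, x 3] / sqForm c₂ c₃ ![x 4, x 5, x 6, 0] := by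
        rw [eq_div_iff hne, ← CharTwo.add_eq_zero]
        linear_combination hx'
      rw [this]
      exact div_mem ⟨_, rfl⟩ ⟨_, rfl⟩
    rw [h2, mul_zero, add_zero] at hx'
    have e1 := h.eq_zero_of_sqForm hx'
    have e2 := h.eq_zero_of_sqForm h2
    funext i
    fin_cases i
    · exact congrFun e1 0
    · exact congrFun e1 1
    · exact congrFun e1 2
    · exact congrFun e1 3
    · exact congrFun e2 0
    · exact congrFun e2 1
    · exact congrFun e2 2
  have ht : t ≠ 0 := fun ht =>
    Polynomial.X_ne_zero (hc.transcendental Polynomial.X (by simpa using ht))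
  have hsub : ∀ (M M' : Matrix (Fin 7) (Fin 7) k) (x : Fin 7 → k),
      matQF (M - M') x = matQF M x - matQF M' x := by
    intro M M' x
    simp [matQF, sub_mul, Finset.sum_sub_distrib]
  intro x hx
  refine hc.eq_zero_of_isotropic _ (sevenMat c₂ c₃ a η - sevenMat c₂ c₃ a 0) hA x ?_
  rw [Matrix.map_sub _ (map_sub c), hsub]
  simp only [sevenMat_map, matQF_sevenMat] at hx ⊢
  field_simp at hx
  rw [map_zero]
  linear_combination hx

theorem SqAniso.ratExt (h : SqAniso a b c₂ c₃) {k : Type} [Field k] [CharP k 2] {c : F →+* k}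
    {t : k} (hc : IsRationalExtension c t) : SqAniso (c a) (c b) (c c₂) (c c₃) := by
  have hA : MatAniso (!![a, 1, 0, 0, 0, 0; 0, b, 0, 0, 0, 0; 0, 0, 1, 0, 0, 0; 0, 0, 0, c₂, 0, 0;
      0, 0, 0, 0, c₃, 0; 0, 0, 0, 0, 0, c₂ * c₃]) := by
    intro x hx
    obtain ⟨h0, h1, h2⟩ := h (x 0) (x 1) ![x 2, x 3, x 4, x 5] (by
      rw [← hx]
      simp [matQF, Fin.sum_univ_six, sqForm_apply]
      ring)
    funext i
    fin_cases i
    · exact h0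
    · exact h1
    · exact congrFun h2 0
    · exact congrFun h2 1
    · exact congrFun h2 2
    · exact congrFun h2 3
  intro x y k hk
  have := hc.matAniso hA ![x, y, k 0, k 1, k 2, k 3] (by
    rw [← hk]
    simp [matQF, Fin.sum_univ_six, sqForm_apply]
    ring)
  refine ⟨congrFun this 0, congrFun this 1, ?_⟩
  funext i
  fin_cases i
  · exact congrFun this 2
  · exact congrFun this 3
  · exact congrFun this 4
  · exact congrFun this 5

theorem not_hasCoreEquation (h : SqAniso a b c₂ c₃) :
    ¬ HasCoreEquation a b c₂ c₃ (innerPoly a b ![c₂, c₃, c₂ * c₃]) := by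
  classical
  rintro ⟨x, y, u, v, hv, heq⟩
  obtain ⟨ζ, hζ1, hζ⟩ := exists_good_point h (.inl 1) hv
  obtain ⟨k₀, _, _, d₀, t, h₀⟩ := exists_isRationalExtension F
  obtain ⟨k₁, _, _, d₁, s, h₁⟩ := exists_isRationalExtension k₀
  obtain ⟨k₂, _, _, d₂, z, h₂⟩ := exists_isRationalExtension k₁
  obtain ⟨k₃, _, _, d₃, w, h₃⟩ := exists_isRationalExtension k₂
  set η := ζ (.inl 1) with hη
  have ht : t ≠ 0 := fun ht =>
    Polynomial.X_ne_zero (h₀.transcendental Polynomial.X (by simpa using ht))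
  set g₀ : Fin 2 ⊕ Fin 3 → k₀ := fun i => if i = .inr 2 then t else d₀ (ζ i) with hg₀
  set g₁ : Fin 2 ⊕ Fin 3 → k₁ := fun i => if i = .inl 0 then s else d₁ (g₀ i) with hg₁
  set g₂ : Fin 2 ⊕ Fin 3 → k₂ := fun i => if i = .inr 1 then z else d₂ (g₁ i) with hg₂
  set g₃ : Fin 2 ⊕ Fin 3 → k₃ := fun i => if i = .inr 0 then w else d₃ (g₂ i) with hg₃
  have hS : SpecializesTo (d₃.comp (d₂.comp (d₁.comp (d₀.comp (RingHom.id F))))) g₃ ζ :=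
    ((((specializesTo_base (RingHom.id F) ζ).extend h₀ (.inr 2) (g' := g₀)
      (by simp [hg₀]) (fun i hi => by simp [hg₀, hi])).extend h₁ (.inl 0) (g' := g₁)
      (by simp [hg₁]) (fun i hi => by simp [hg₁, hi])).extend h₂ (.inr 1) (g' := g₂)
      (by simp [hg₂]) (fun i hi => by simp [hg₂, hi])).extend h₃ (.inr 0)
      (by simp [hg₃]) (fun i hi => by simp [hg₃, hi])
  set θ := eval₂Hom (d₃.comp (d₂.comp (d₁.comp (d₀.comp (RingHom.id F))))) g₃ with hθ
  have hθC : ∀ r, θ (C r) = d₃ (d₂ (d₁ (d₀ r))) := fun r => by simp [hθ]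
  have e := congrArg θ heq
  have hvθ : (fun i => θ (v i)) ≠ 0 := by
    intro h0
    apply hζ
    apply hS
    change θ _ = 0
    rw [map_triForm, h0]
    simp [triForm]
  simp only [map_add, map_mul, map_pow, map_triForm, hθC] at e
  have hδ : θ (innerPoly a b ![c₂, c₃, c₂ * c₃]) =
      d₃ (d₂ (d₁ (d₀ a))) * d₃ (d₂ s) ^ 2 + d₃ (d₂ s) * d₃ (d₂ (d₁ (d₀ η))) +
        d₃ (d₂ (d₁ (d₀ b))) * d₃ (d₂ (d₁ (d₀ η))) ^ 2 + (d₃ (d₂ (d₁ (d₀ c₂))) * w ^ 2 +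
          d₃ (d₂ (d₁ (d₀ c₃))) * d₃ z ^ 2 +
          d₃ (d₂ (d₁ (d₀ c₂))) * d₃ (d₂ (d₁ (d₀ c₃))) * d₃ (d₂ (d₁ t)) ^ 2) := by
    simp [innerPoly, hθ, Fin.sum_univ_three, hg₃, hg₂, hg₁, hg₀, hη]
  have hP := matAniso_sevenMat_ratExt h h₀ η
  have hd0 : d₀ η / t ≠ 0 := by simp [hζ1, ht]
  obtain ⟨p, hp⟩ := exists_sevenMat_representation (s := d₃ (d₂ (d₁ (d₀ η / t))))
    (t := d₃ (d₂ (d₁ t))) (η := d₃ (d₂ (d₁ (d₀ η)))) (by simpa using hζ1) (by simpa using ht)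
    (by rw [← map_mul, ← map_mul, ← map_mul, div_mul_cancel₀ _ ht])
    (by
      have := h₃.matAniso (h₂.matAniso (h₁.matAniso hP))
      rwa [sevenMat_map, sevenMat_map, sevenMat_map] at this) hvθ (e.trans (by rw [hδ]))
  obtain ⟨p₀, p₁, e0, e01, e1⟩ := exists_representation_sevenMat h₁ h₂ h₃ hd0 hP p
    (η := d₀ η) (f₀ := d₀ b * d₀ η ^ 2 + d₀ c₂ * d₀ c₃ * t ^ 2) (by
      rw [sevenMat_map, sevenMat_map, sevenMat_map, hp]
      simp
      ring)
  have hk := h.ratExt h₀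
  have hch : (2 : k₀) = 0 := CharTwo.two_eq_zero
  have e := matQF_comb (fiveMat (d₀ c₂) (d₀ c₃) (d₀ a) (d₀ η / t)) 1 (p₀ 4 / p₁ 4) p₀ p₁
  by_cases h4 : p₁ 4 = 0
  · rw [matQF_fiveMat, h4] at e1
    refine one_ne_zero (hk 1 0 ![p₁ 0, p₁ 1, p₁ 2, p₁ 3] ?_).1
    simp [sqForm_apply]
    linear_combination e1 + d₀ a * hch
  · rw [e0, e01, e1, matQF_fiveMat] at e
    have hw : 1 * p₀ 4 + p₀ 4 / p₁ 4 * p₁ 4 = 0 := by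
      field_simp
      linear_combination p₀ 4 * hch
    simp only [hw] at e
    have := (hk (p₀ 4 / p₁ 4) (d₀ η) ![1 * p₀ 0 + p₀ 4 / p₁ 4 * p₁ 0,
      1 * p₀ 1 + p₀ 4 / p₁ 4 * p₁ 1, 1 * p₀ 2 + p₀ 4 / p₁ 4 * p₁ 2,
      1 * p₀ 3 + p₀ 4 / p₁ 4 * p₁ 3 + t] ?_).2.1
    · exact hζ1 (by simpa using this)
    · rw [sqForm_apply]
      simp only [Matrix.cons_val]
      rw [CharTwo.add_sq (_ + _) t]
      linear_combination e + (d₀ a * (p₀ 4 / p₁ 4) ^ 2 + (p₀ 4 / p₁ 4) * d₀ η +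
        d₀ b * d₀ η ^ 2 + d₀ c₂ * d₀ c₃ * t ^ 2) * hch

end Core

section Modulo

variable {F : Type} [Field F]

/-- The form `[a,b] ⊥ ⟨1,c₂,c₃⟩` is isotropic modulo the polynomial `P`. -/
def IsotropicModulo {τ : Type} (a b c₂ c₃ : F) (P : MvPolynomial τ F) : Prop :=
  ∃ (x y : MvPolynomial τ F) (u : Fin 3 → MvPolynomial τ F),
    ¬ (P ∣ x ∧ P ∣ y ∧ ∀ i, P ∣ u i) ∧
      P ∣ C a * x ^ 2 + x * y + C b * y ^ 2 + triForm (C c₂) (C c₃) u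

/-- The linear change of variables attached to a linear map. -/
noncomputable def linearSubst {τ τ' : Type} [Fintype τ] [DecidableEq τ]
    (L : (τ → F) →ₗ[F] (τ' → F)) : MvPolynomial τ' F →ₐ[F] MvPolynomial τ F :=
  aeval fun k => ∑ i, C (L (Pi.single i 1) k) * X i

theorem eval_linearSubst {τ τ' : Type} [Fintype τ] [DecidableEq τ]
    (L : (τ → F) →ₗ[F] (τ' → F)) (p : MvPolynomial τ' F) (x : τ → F) :
    eval x (linearSubst L p) = eval (L x) p := by
  have hL : ∀ k, L x k = ∑ i, L (Pi.single i 1) k * x i := by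
    intro k
    conv_lhs => rw [pi_eq_sum_univ x]
    rw [map_sum, Finset.sum_apply]
    refine Finset.sum_congr rfl fun i _ => ?_
    rw [map_smul, Pi.smul_apply, smul_eq_mul, mul_comm]
    have : (fun j => if i = j then (1 : F) else 0) = Pi.single i 1 := by
      funext j
      simp [Pi.single_apply, eq_comm]
    rw [this]
  induction p using MvPolynomial.induction_on with
  | C r => simp [linearSubst]
  | add p q hp hq => simp [hp, hq]
  | mul_X p k hp =>
    rw [map_mul, map_mul, map_mul, hp, eval_X, hL]
    simp [linearSubst]

theorem IsotropicModulo.transfer {τ τ' : Type} [Fintype τ] [DecidableEq τ] [Fintype τ']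
    [DecidableEq τ'] [Infinite F] {a b c₂ c₃ ρ : F} (hρ : ρ ≠ 0)
    (L : (τ → F) ≃ₗ[F] (τ' → F)) {P : MvPolynomial τ' F} {P' : MvPolynomial τ F}
    (hP : ∀ x, ρ * eval x P' = eval (L x) P) (h : IsotropicModulo a b c₂ c₃ P) :
    IsotropicModulo a b c₂ c₃ P' := by
  set f := linearSubst (L : (τ → F) →ₗ[F] (τ' → F))
  set g := linearSubst (L.symm : (τ' → F) →ₗ[F] (τ → F))
  have hgf : ∀ p, g (f p) = p := fun p => MvPolynomial.funext fun x => by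
    simp [f, g, eval_linearSubst]
  have hfP : f P = C ρ * P' := MvPolynomial.funext fun x => by
    simp [f, eval_linearSubst, hP]
  have hdvd : P' ∣ f P := ⟨C ρ, by rw [hfP, mul_comm]⟩
  have hdvd' : f P ∣ P' := ⟨C ρ⁻¹, by
    rw [hfP, mul_comm (C ρ) P', mul_assoc, ← C_mul, mul_inv_cancel₀ hρ, C_1, mul_one]⟩
  have hback : ∀ p, P' ∣ f p → P ∣ p := fun p hp => by
    have := map_dvd g (hdvd'.trans hp)
    rwa [hgf, hgf] at this
  obtain ⟨x, y, u, hne, hd⟩ := h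
  refine ⟨f x, f y, fun i => f (u i), fun ⟨hx, hy, hu⟩ =>
    hne ⟨hback _ hx, hback _ hy, fun i => hback _ (hu i)⟩, ?_⟩
  have := hdvd.trans (map_dvd f hd)
  have hC : ∀ r, f (C r) = C r := fun r => by simp [f, linearSubst]
  rw [map_add, map_add, map_add, map_mul, map_mul, map_mul, map_pow, map_pow, hC, hC] at this
  have ht := map_triForm (f : MvPolynomial τ' F →+* MvPolynomial τ F) (C c₂) (C c₃) u
  simp only [AlgHom.coe_toRingHom, hC] at ht
  rwa [ht] at this

variable [CharP F 2] {a b c₂ c₃ : F}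

theorem SqAniso.mvPolynomial_eq_zero (h : SqAniso a b c₂ c₃) {σ : Type} {x y : MvPolynomial σ F}
    {u : Fin 3 → MvPolynomial σ F}
    (hx : C a * x ^ 2 + x * y + C b * y ^ 2 + triForm (C c₂) (C c₃) u = 0) :
    x = 0 ∧ y = 0 ∧ u = 0 := by
  have := h.infinite
  have key : ∀ ζ : σ → F, eval ζ x = 0 ∧ eval ζ y = 0 ∧
      ![eval ζ (u 0), eval ζ (u 1), eval ζ (u 2), 0] = 0 := fun ζ => h _ _ _ (by
    have := congrArg (eval ζ) hx
    simpa [triForm, sqForm_apply] using this)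
  refine ⟨MvPolynomial.funext fun ζ => by simpa using (key ζ).1,
    MvPolynomial.funext fun ζ => by simpa using (key ζ).2.1, funext fun i =>
      MvPolynomial.funext fun ζ => ?_⟩
  have h3 := (key ζ).2.2
  rw [Pi.zero_apply, map_zero]
  fin_cases i
  · exact congrFun h3 0
  · exact congrFun h3 1
  · exact congrFun h3 2

theorem hasCoreEquation_of_multiplier (h : SqAniso a b c₂ c₃) {σ : Type}
    {δ x₀ x₁ y₀ y₁ s₀ s₁ : MvPolynomial σ F} {u₀ u₁ : Fin 3 → MvPolynomial σ F}
    (heq : C a * x₀ ^ 2 + x₀ * y₀ + C b * y₀ ^ 2 + triForm (C c₂) (C c₃) u₀ =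
      δ * (C a * x₁ ^ 2 + x₁ * y₁ + C b * y₁ ^ 2 + triForm (C c₂) (C c₃) u₁))
    (hx : s₁ * x₀ + s₀ * x₁ = 0) (hy : s₁ * y₀ + s₀ * y₁ = 0)
    (hne : s₀ * x₀ + δ * s₁ * x₁ = 0 → s₀ * y₀ + δ * s₁ * y₁ = 0 →
      (∀ i, s₀ * u₀ i + δ * s₁ * u₁ i = 0) → (∀ i, s₁ * u₀ i + s₀ * u₁ i = 0) → False) :
    HasCoreEquation a b c₂ c₃ δ := by
  have hch : (2 : MvPolynomial σ F) = 0 := CharTwo.two_eq_zero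
  have hx2 : s₁ ^ 2 * x₀ ^ 2 + s₀ ^ 2 * x₁ ^ 2 = 0 := by
    rw [← mul_pow, ← mul_pow, ← CharTwo.add_sq, hx, zero_pow two_ne_zero]
  have hy2 : s₁ ^ 2 * y₀ ^ 2 + s₀ ^ 2 * y₁ ^ 2 = 0 := by
    rw [← mul_pow, ← mul_pow, ← CharTwo.add_sq, hy, zero_pow two_ne_zero]
  have hxy : (s₁ * x₀ + s₀ * x₁) * (s₁ * y₀ + s₀ * y₁) = 0 := by rw [hx, zero_mul]
  have key : C a * (s₀ * x₀ + δ * s₁ * x₁) ^ 2 +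
      (s₀ * x₀ + δ * s₁ * x₁) * (s₀ * y₀ + δ * s₁ * y₁) + C b * (s₀ * y₀ + δ * s₁ * y₁) ^ 2 =
      triForm (C c₂) (C c₃) (fun i => s₀ * u₀ i + δ * s₁ * u₁ i) +
        δ * triForm (C c₂) (C c₃) (fun i => s₁ * u₀ i + s₀ * u₁ i) := by
    simp only [triForm, CharTwo.add_sq, mul_pow] at heq ⊢
    linear_combination (s₀ ^ 2 + δ * s₁ ^ 2) * heq + δ * C a * hx2 + δ * C b * hy2 + δ * hxy +
      (δ ^ 2 * s₁ ^ 2 * (C a * x₁ ^ 2 + x₁ * y₁ + C b * y₁ ^ 2) -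
        δ * s₁ ^ 2 * (C a * x₀ ^ 2 + x₀ * y₀ + C b * y₀ ^ 2) -
        (s₀ ^ 2 + δ * s₁ ^ 2) * (u₀ 0 ^ 2 + C c₂ * u₀ 1 ^ 2 + C c₃ * u₀ 2 ^ 2)) * hch
  refine ⟨_, _, fun i => s₀ * u₀ i + δ * s₁ * u₁ i, fun i => s₁ * u₀ i + s₀ * u₁ i,
    fun hv => ?_, key⟩
  rw [hv] at key
  obtain ⟨h1, h2, h3⟩ := h.mvPolynomial_eq_zero
    (u := fun i => s₀ * u₀ i + δ * s₁ * u₁ i) (CharTwo.add_eq_zero.2 (key.trans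
    (by simp [triForm])))
  exact hne h1 h2 (congrFun h3) (congrFun hv)

theorem IsotropicModulo.exists_linear_representation [Infinite F] {m : ℕ} {e f : F}
    {d : Fin m → F} {P : MvPolynomial (Option (Fin 2 ⊕ Fin m)) F}
    (hP : ∀ x, eval x P = normalForm e f d x) (hiso : IsotropicModulo a b c₂ c₃ P) :
    ∃ (x₀ x₁ y₀ y₁ : MvPolynomial (Fin 2 ⊕ Fin m) F)
      (u₀ u₁ : Fin 3 → MvPolynomial (Fin 2 ⊕ Fin m) F),
      C a * x₀ ^ 2 + x₀ * y₀ + C b * y₀ ^ 2 + triForm (C c₂) (C c₃) u₀ =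
        innerPoly e f d * (C a * x₁ ^ 2 + x₁ * y₁ + C b * y₁ ^ 2 + triForm (C c₂) (C c₃) u₁) ∧
      x₀ * y₁ + x₁ * y₀ = 0 ∧
      ¬ (x₀ = 0 ∧ x₁ = 0 ∧ y₀ = 0 ∧ y₁ = 0 ∧ u₀ = 0 ∧ u₁ = 0) := by
  obtain ⟨x, y, u, hne, hd⟩ := hiso
  set δ := innerPoly e f d with hδ
  set E := optionEquivLeft F (Fin 2 ⊕ Fin m) with hE
  set M : Polynomial (MvPolynomial (Fin 2 ⊕ Fin m) F) := Polynomial.X ^ 2 + Polynomial.C δ with hM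
  have hEsome : ∀ p, E (rename some p) = Polynomial.C p := by
    intro p
    induction p using MvPolynomial.induction_on with
    | C r => simp [hE, optionEquivLeft_C]
    | add p q hp hq => simp [hp, hq]
    | mul_X p k hp =>
      rw [map_mul, map_mul, hp, rename_X, hE, optionEquivLeft_X_some, ← Polynomial.C_mul]
  have hEC : ∀ r, E (C r) = Polynomial.C (C r) := fun r => by
    rw [← hEsome, rename_C]
  have hEP : E P = M := by
    have : P = X none ^ 2 + rename some δ := MvPolynomial.funext fun x => by
      rw [hP, map_add, map_pow, eval_X, eval_rename]
      simp [hδ, innerPoly, normalForm]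
      ring
    rw [this, map_add, map_pow, hEsome, hE, optionEquivLeft_X_none]
  have hMmon : M.Monic := Polynomial.monic_X_pow_add_C δ two_ne_zero
  have hMdeg : M.degree = 2 := Polynomial.degree_X_pow_add_C two_pos δ
  set π := Ideal.Quotient.mk (Ideal.span {M}) with hπ
  set ι := π.comp Polynomial.C with hι
  set ξ := π Polynomial.X with hξ
  have hdvd : ∀ p, π p = 0 ↔ M ∣ p := fun p => by
    rw [hπ, Ideal.Quotient.eq_zero_iff_mem, Ideal.mem_span_singleton]
  have hξ2 : ξ ^ 2 + ι δ = 0 := by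
    have : π (Polynomial.X ^ 2 + Polynomial.C δ) = 0 := (hdvd M).2 dvd_rfl
    rwa [map_add, map_pow] at this
  have hch : (2 : Polynomial (MvPolynomial (Fin 2 ⊕ Fin m) F) ⧸ Ideal.span {M}) = 0 := by
    have h2 : (2 : Polynomial (MvPolynomial (Fin 2 ⊕ Fin m) F)) = 0 := CharTwo.two_eq_zero
    rw [← map_ofNat π 2]
    exact (congrArg π h2).trans (map_zero π)
  have hlin : ∀ r₀ r₁, ι r₀ + ι r₁ * ξ = 0 → r₀ = 0 ∧ r₁ = 0 := by
    intro r₀ r₁ h0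
    have h1 : π (Polynomial.C r₁ * Polynomial.X + Polynomial.C r₀) = 0 := by
      rw [← h0]
      simp [hι, hξ]
      ring
    have h2 := Polynomial.eq_zero_of_dvd_of_degree_lt ((hdvd _).1 h1) (by
      rw [hMdeg]
      exact Polynomial.degree_linear_le.trans_lt (by norm_num))
    exact ⟨by simpa using congrArg (Polynomial.coeff · 0) h2,
      by simpa using congrArg (Polynomial.coeff · 1) h2⟩
  have hred : ∀ w, ∃ r₀ r₁, π (E w) = ι r₀ + ι r₁ * ξ := by
    intro w
    have hdeg : (E w %ₘ M).natDegree ≤ 1 := by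
      have := Polynomial.natDegree_modByMonic_lt (E w) hMmon (by
        intro h1
        rw [h1, Polynomial.degree_one] at hMdeg
        exact absurd hMdeg (by norm_num))
      rw [show M.natDegree = 2 from Polynomial.natDegree_X_pow_add_C] at this
      omega
    obtain ⟨r₁, r₀, hr⟩ := Polynomial.exists_eq_X_add_C_of_natDegree_le_one hdeg
    refine ⟨r₀, r₁, ?_⟩
    have h1 : π (E w) = π (E w %ₘ M) := by
      rw [← sub_eq_zero, ← map_sub, hdvd]
      exact ⟨E w /ₘ M, by linear_combination -Polynomial.modByMonic_add_div (E w) M⟩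
    rw [h1, hr]
    simp [hι, hξ]
    ring
  have hne' : ¬ (π (E x) = 0 ∧ π (E y) = 0 ∧ ∀ i, π (E (u i)) = 0) := by
    simp only [hdvd, ← hEP, map_dvd_iff]
    exact hne
  have hφ : π (E (C a * x ^ 2 + x * y + C b * y ^ 2 + triForm (C c₂) (C c₃) u)) = 0 := by
    rw [hdvd, ← hEP]
    exact map_dvd E hd
  obtain ⟨x₀, x₁, hx⟩ := hred x
  obtain ⟨y₀, y₁, hy⟩ := hred y
  choose u₀ u₁ hu using fun i => hred (u i)
  have hπC : ∀ r, π (E (C r)) = ι (C r) := fun r => by rw [hEC]; rfl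
  have h2 : (C a * x₀ ^ 2 + x₀ * y₀ + C b * y₀ ^ 2 + triForm (C c₂) (C c₃) u₀) +
      δ * (C a * x₁ ^ 2 + x₁ * y₁ + C b * y₁ ^ 2 + triForm (C c₂) (C c₃) u₁) = 0 ∧
      x₀ * y₁ + x₁ * y₀ = 0 := by
    apply hlin
    simp only [triForm, map_add, map_mul, map_pow, hπC, hx, hy, hu] at hφ ⊢
    linear_combination hφ - (ι (C a) * ι x₁ ^ 2 + ι x₁ * ι y₁ + ι (C b) * ι y₁ ^ 2 +
      (ι (u₁ 0) ^ 2 + ι (C c₂) * ι (u₁ 1) ^ 2 + ι (C c₃) * ι (u₁ 2) ^ 2)) * hξ2 +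
      (ι δ * (ι (C a) * ι x₁ ^ 2 + ι x₁ * ι y₁ + ι (C b) * ι y₁ ^ 2 +
      (ι (u₁ 0) ^ 2 + ι (C c₂) * ι (u₁ 1) ^ 2 + ι (C c₃) * ι (u₁ 2) ^ 2)) -
      (ι (C a) * ι x₀ * ι x₁ + ι (C b) * ι y₀ * ι y₁ + (ι (u₀ 0) * ι (u₁ 0) +
      ι (C c₂) * ι (u₀ 1) * ι (u₁ 1) + ι (C c₃) * ι (u₀ 2) * ι (u₁ 2))) * ξ) * hch
  refine ⟨x₀, x₁, y₀, y₁, u₀, u₁, CharTwo.add_eq_zero.1 h2.1, h2.2, ?_⟩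
  rintro ⟨rfl, rfl, rfl, rfl, rfl, rfl⟩
  have hz : ι 0 + ι 0 * ξ = 0 := by rw [map_zero]; ring
  exact hne' ⟨hx.trans hz, hy.trans hz, fun i => (hu i).trans hz⟩

theorem IsotropicModulo.hasCoreEquation (h : SqAniso a b c₂ c₃) {m : ℕ} {e f : F} {d : Fin m → F}
    (hψ : ∀ x, normalForm e f d x = 0 → x = 0)
    {P : MvPolynomial (Option (Fin 2 ⊕ Fin m)) F} (hP : ∀ x, eval x P = normalForm e f d x)
    (hiso : IsotropicModulo a b c₂ c₃ P) : HasCoreEquation a b c₂ c₃ (innerPoly e f d) := by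
  have := h.infinite
  obtain ⟨x₀, x₁, y₀, y₁, u₀, u₁, heq, hpol, hne⟩ := hiso.exists_linear_representation hP
  have hnorm : ∀ p q : MvPolynomial (Fin 2 ⊕ Fin m) F, q ≠ 0 →
      p * p + innerPoly e f d * q * q ≠ 0 := by
    intro p q hq h0
    obtain ⟨ζ, hζ⟩ : ∃ ζ, eval ζ (q * X (.inl 1)) ≠ 0 := by
      by_contra hcon
      push Not at hcon
      exact mul_ne_zero hq (X_ne_zero _) (MvPolynomial.funext fun ζ => by simpa using hcon ζ)
    rw [map_mul, eval_X, mul_ne_zero_iff] at hζ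
    have h1 := hψ (fun i => i.elim (eval ζ p) (fun i => eval ζ q * ζ i)) (by
      have := congrArg (eval ζ) h0
      simp only [innerPoly, map_add, map_mul, map_pow, eval_C, eval_X, map_sum,
        map_zero] at this
      simp only [normalForm, Option.elim_none, Option.elim_some, mul_pow]
      rw [← this]
      simp only [add_mul, Finset.sum_mul]
      rw [Finset.sum_congr rfl fun j _ => show d j * (eval ζ q ^ 2 * ζ (.inr j) ^ 2) =
        d j * ζ (.inr j) ^ 2 * eval ζ q * eval ζ q by ring]
      ring)
    exact mul_ne_zero hζ.1 hζ.2 (congrFun h1 (some (.inl 1)))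
  by_cases hx1 : x₁ = 0
  · by_cases hy1 : y₁ = 0
    · refine hasCoreEquation_of_multiplier (s₀ := 1) (s₁ := 0) h heq (by simp [hx1])
        (by simp [hy1]) fun k1 k2 k3 k4 => hne ⟨?_, hx1, ?_, hy1, funext fun i => ?_,
          funext fun i => ?_⟩
      · simpa using k1
      · simpa using k2
      · simpa using k3 i
      · simpa using k4 i
    · exact hasCoreEquation_of_multiplier (s₀ := y₀) (s₁ := y₁) h heq
        (by linear_combination hpol) (by rw [mul_comm, CharTwo.add_self_eq_zero])
        fun _ k2 _ _ => hnorm _ _ hy1 k2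
  · exact hasCoreEquation_of_multiplier (s₀ := x₀) (s₁ := x₁) h heq
      (by rw [mul_comm, CharTwo.add_self_eq_zero]) (by linear_combination hpol)
      fun k1 _ _ _ => hnorm _ _ hx1 k1

/-- The form `[a,b] ⊥ ⟨1,c₂,c₃⟩` stays anisotropic over the function field of a normal form
with at least four quasilinear entries. -/
theorem SqAniso.not_isotropicModulo (h : SqAniso a b c₂ c₃) {m : ℕ} (hm : 3 ≤ m) {e f : F}
    {d : Fin m → F} (hψ : ∀ x, normalForm e f d x = 0 → x = 0)
    {P : MvPolynomial (Option (Fin 2 ⊕ Fin m)) F} (hP : ∀ x, eval x P = normalForm e f d x) :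
    ¬ IsotropicModulo a b c₂ c₃ P := by
  intro hiso
  have := h.infinite
  obtain ⟨ρ, hρ, Θ, hΘ⟩ := (hiso.hasCoreEquation h hψ hP).exists_similarity h
  have hinj : Function.Injective Θ := (injective_iff_map_eq_zero _).2 fun x hx =>
    hψ x (by rw [← hΘ, hx]; simp [normalForm])
  have hdim := LinearMap.finrank_le_finrank_of_injective hinj
  simp only [Module.finrank_fintype_fun_eq_card, Fintype.card_option, Fintype.card_sum,
    Fintype.card_fin] at hdim
  obtain rfl : m = 3 := by omega
  set L := LinearEquiv.ofInjectiveEndo Θ hinj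
  have hL : ∀ x, ρ * normalForm a b ![c₂, c₃, c₂ * c₃] x = normalForm e f d (L.symm x) := by
    intro x
    rw [← hΘ]
    congr 2
    exact (L.apply_symm_apply x).symm
  have hsq : ∀ x, normalForm a b ![c₂, c₃, c₂ * c₃] x = 0 → x = 0 := fun x hx => by
    have := hψ (L.symm x) (by rw [← hL, hx, mul_zero])
    simpa using this
  set P' : MvPolynomial (Option (Fin 2 ⊕ Fin 3)) F :=
    X none ^ 2 + rename some (innerPoly a b ![c₂, c₃, c₂ * c₃])
  have hP' : ∀ x, eval x P' = normalForm a b ![c₂, c₃, c₂ * c₃] x := fun x => by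
    simp only [P', map_add, map_pow, eval_X, eval_rename]
    simp [innerPoly, normalForm]
    ring
  refine not_hasCoreEquation h ((hiso.transfer hρ L.symm fun x => ?_).hasCoreEquation h hsq hP')
  rw [hP', hP, hL]

end Modulo

section NormalForm

variable {F : Type} [Field F]

theorem toQuadraticMap'_apply {R : Type} [CommRing R] {n : ℕ} (M : Matrix (Fin n) (Fin n) R)
    (x : Fin n → R) : M.toQuadraticMap' x = ∑ i, ∑ j, M i j * (x i * x j) := by
  change Matrix.toLinearMap₂' R M x x = _
  simp [Matrix.toLinearMap₂'_apply, mul_left_comm, mul_comm]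

theorem binQF_apply (a b : F) (v : Fin 2 → F) :
    binQF a b v = a * v 0 ^ 2 + v 0 * v 1 + b * v 1 ^ 2 := by
  rw [binQF, toQuadraticMap'_apply]
  simp [Fin.sum_univ_two]
  ring

theorem HasTypeRS.exists_normalForm {V : Type} [AddCommGroup V] [Module F V]
    {ψ : QuadraticForm F V} (hψ : ψ.Anisotropic) {m : ℕ} (ht : HasTypeRS ψ 1 (m + 1)) :
    ∃ (ε e f : F) (d : Fin m → F) (L : (Option (Fin 2 ⊕ Fin m) → F) ≃ₗ[F] V), ε ≠ 0 ∧
      ∀ x, ψ (L x) = ε * normalForm e f d x := by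
  obtain ⟨a, b, c, ⟨i⟩⟩ := ht
  have hc : c 0 ≠ 0 := by
    intro hc
    have h0 := hψ (i.symm (0, Pi.single 0 1)) (by
      rw [i.symm.map_app]
      simp [diagQF, weightedSumSquares_apply, Pi.single_apply, hc])
    rw [← i.symm.map_zero] at h0
    have := i.symm.toLinearEquiv.injective h0
    simpa using congrFun (congrArg Prod.snd this) 0
  set ε := c 0
  let pr (i : Option (Fin 2 ⊕ Fin m)) : (Option (Fin 2 ⊕ Fin m) → F) →ₗ[F] F := LinearMap.proj i
  let K : (Option (Fin 2 ⊕ Fin m) → F) →ₗ[F] (Fin 1 → Fin 2 → F) × (Fin (m + 1) → F) :=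
    (LinearMap.pi fun _ => LinearMap.pi
      ![pr (some (.inl 0)), ε • pr (some (.inl 1))]).prod
        (LinearMap.pi (Fin.cons (pr none) fun j => pr (some (.inr j))))
  have hK : Function.Injective K := by
    refine (injective_iff_map_eq_zero _).2 fun x hx => ?_
    have h1 := congrFun (congrFun (congrArg Prod.fst hx) 0)
    have h2 := congrFun (congrArg Prod.snd hx)
    funext k
    match k with
    | none => exact h2 0
    | some (.inl 0) => exact h1 0
    | some (.inl 1) => simpa [K, pr, hc] using h1 1
    | some (.inr j) => exact h2 j.succ
  have hdim : Module.finrank F (Option (Fin 2 ⊕ Fin m) → F) =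
      Module.finrank F ((Fin 1 → Fin 2 → F) × (Fin (m + 1) → F)) := by
    simp [Module.finrank_pi_fintype]
    ring
  refine ⟨ε, a 0 / ε, b 0 * ε, fun j => c j.succ / ε,
    (K.linearEquivOfInjective hK hdim).trans i.symm.toLinearEquiv, hc, fun x => ?_⟩
  have h1 : ψ (((K.linearEquivOfInjective hK hdim).trans i.symm.toLinearEquiv) x) =
      ((binsQF a b).prod (diagQF c)) (K x) := by
    simp only [LinearEquiv.trans_apply]
    exact i.symm.map_app _
  have h2 : K x = (fun _ => ![x (some (.inl 0)), ε * x (some (.inl 1))],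
      Fin.cons (x none) fun j => x (some (.inr j))) := by
    refine Prod.ext (funext fun _ => funext fun i => ?_) (funext fun i => ?_)
    · fin_cases i <;> rfl
    · refine Fin.cases ?_ (fun j => ?_) i <;> rfl
  rw [h1, h2, prod_apply, binsQF, pi_apply, Fin.sum_univ_one, diagQF, weightedSumSquares_apply,
    Fin.sum_univ_succ]
  simp only [binQF_apply, normalForm, Fin.cons_zero,
    Fin.cons_succ, Matrix.cons_val_zero, Matrix.cons_val_one, smul_eq_mul, mul_add, Finset.mul_sum]
  rw [Finset.sum_congr rfl fun j _ => show ε * (c j.succ / ε * x (some (.inr j)) ^ 2) =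
    c j.succ * (x (some (.inr j)) * x (some (.inr j))) by field_simp]
  field_simp
  ring

theorem eq_zero_of_normalForm {V : Type} [AddCommGroup V] [Module F V]
    {ψ : QuadraticForm F V} (hψ : ψ.Anisotropic) {m : ℕ} {ε e f : F} {d : Fin m → F}
    {L : (Option (Fin 2 ⊕ Fin m) → F) ≃ₗ[F] V} (hL : ∀ x, ψ (L x) = ε * normalForm e f d x)
    (x : Option (Fin 2 ⊕ Fin m) → F) (hx : normalForm e f d x = 0) : x = 0 := by
  have := hψ (L x) (by rw [hL, hx, mul_zero])
  simpa using this

theorem pfisterQF_two_apply (u : Fin 2 → F) (c : F) (v : Finset (Fin 2) → Fin 2 → F) :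
    pfisterQF 2 u c v = binQF 1 c (v ∅) + u 0 * binQF 1 c (v {0}) + u 1 * binQF 1 c (v {1}) +
      u 0 * u 1 * binQF 1 c (v {0, 1}) := by
  have : (Finset.univ : Finset (Finset (Fin 2))) = {∅, {0}, {1}, {0, 1}} := by decide
  rw [pfisterQF, pi_apply, this, Finset.sum_insert (by decide), Finset.sum_insert (by decide),
    Finset.sum_insert (by decide), Finset.sum_singleton]
  simp
  ring

variable [CharP F 2] {a b c₂ c₃ : F}

theorem eq_zero_of_sqForm_of_normalForm (h : ∀ x, normalForm a b ![c₂, c₃] x = 0 → x = 0)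
    {k : Fin 4 → F} (hk : sqForm c₂ c₃ k = 0) : k = 0 := by
  have hch : (2 : F) = 0 := CharTwo.two_eq_zero
  have h' : ∀ z u v : F, z ^ 2 + c₂ * u ^ 2 + c₃ * v ^ 2 = 0 → z = 0 ∧ u = 0 ∧ v = 0 := by
    intro z u v hz
    have := h (fun i => i.elim z (Sum.elim 0 ![u, v])) (by
      simp [normalForm, Fin.sum_univ_two]
      linear_combination hz)
    exact ⟨congrFun this none, congrFun this (some (.inr 0)), congrFun this (some (.inr 1))⟩
  rw [sqForm_apply] at hk
  have h3 := h' (k 0 * k 2 + c₂ * (k 1 * k 3)) (k 0 * k 3 + k 1 * k 2) (k 2 ^ 2 + c₂ * k 3 ^ 2) (by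
    simp only [CharTwo.add_sq]
    linear_combination (k 2 ^ 2 + c₂ * k 3 ^ 2) * hk - c₂ * c₃ * k 2 ^ 2 * k 3 ^ 2 * hch)
  obtain ⟨h2, h4, -⟩ := h' (k 2) (k 3) 0 (by linear_combination h3.2.2)
  obtain ⟨h5, h6, -⟩ := h' (k 0) (k 1) 0 (by rw [h2, h4] at hk; linear_combination hk)
  funext i
  fin_cases i <;> assumption

theorem isPfisterNeighbour_of_normalForm {V : Type} [AddCommGroup V] [Module F V]
    {φ : QuadraticForm F V} (hφ : φ.Anisotropic) {ε : F} (hε : ε ≠ 0)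
    {L : (Option (Fin 2 ⊕ Fin 2) → F) ≃ₗ[F] V}
    (hL : ∀ x, φ (L x) = ε * normalForm a b ![c₂, c₃] x) {x y x' y' k₀ k₁ k₂ : F}
    (h₂ : c₂ ≠ 0) (h₃ : c₃ ≠ 0) (hxy : x * y' + y * x' = 1)
    (h : a * x ^ 2 + x * y + b * y ^ 2 + (k₀ ^ 2 + c₂ * k₁ ^ 2 + c₃ * k₂ ^ 2) = c₂ * c₃) :
    IsPfisterNeighbour φ := by
  have hch : (2 : F) = 0 := CharTwo.two_eq_zero
  let pr (i : Option (Fin 2 ⊕ Fin 2)) : (Option (Fin 2 ⊕ Fin 2) → F) →ₗ[F] F := LinearMap.proj i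
  let p := y' • pr (some (.inl 0)) + x' • pr (some (.inl 1))
  let q := (c₂ * c₃)⁻¹ • (y • pr (some (.inl 0)) + x • pr (some (.inl 1)))
  let G : (Option (Fin 2 ⊕ Fin 2) → F) →ₗ[F] (Finset (Fin 2) → Fin 2 → F) :=
    LinearMap.pi fun S => LinearMap.pi
      (if S = ∅ then ![pr none + k₀ • p, 0] else if S = {0} then ![pr (some (.inr 0)) + k₁ • p, 0]
        else if S = {1} then ![pr (some (.inr 1)) + k₂ • p, 0] else ![p, q])
  set g := a * x' ^ 2 + x' * y' + b * y' ^ 2 with hg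
  have hG : ∀ z, pfisterQF 2 ![c₂, c₃] (c₂ * c₃ * g) (G z) = normalForm a b ![c₂, c₃] z := by
    intro z
    have e0 : G z ∅ = ![z none + k₀ * p z, 0] := by
      funext i; fin_cases i <;> simp [G, pr]
    have e1 : G z {0} = ![z (some (.inr 0)) + k₁ * p z, 0] := by
      funext i; fin_cases i <;> simp [G, pr]
    have e2 : G z {1} = ![z (some (.inr 1)) + k₂ * p z, 0] := by
      funext i; fin_cases i <;> simp [G, pr]
    have e3 : G z {0, 1} = ![p z, q z] := by
      have h1 : ({0, 1} : Finset (Fin 2)) ≠ ∅ := by decide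
      have h2 : ({0, 1} : Finset (Fin 2)) ≠ {0} := by decide
      have h3 : ({0, 1} : Finset (Fin 2)) ≠ {1} := by decide
      funext i; fin_cases i <;> simp [G, h1, h2, h3]
    have hp : p z = y' * z (some (.inl 0)) + x' * z (some (.inl 1)) := by simp [p, pr]
    have hq : c₂ * c₃ * q z = y * z (some (.inl 0)) + x * z (some (.inl 1)) := by
      simp [q, pr]; field_simp
    rw [pfisterQF_two_apply, e0, e1, e2, e3]
    simp only [binQF_apply, normalForm, Fin.sum_univ_two, Matrix.cons_val_zero,
      Matrix.cons_val_one]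
    obtain ⟨Q, hQ⟩ : ∃ Q, Q = c₂ * c₃ * q z := ⟨_, rfl⟩
    obtain ⟨P, hP⟩ : ∃ P, P = p z := ⟨_, rfl⟩
    rw [← hQ] at hq
    rw [← hP] at hp ⊢
    have hX : z (some (.inl 0)) = P * x + Q * x' := by
      rw [hp, hq]
      linear_combination -z (some (.inl 0)) * hxy - x * x' * z (some (.inl 1)) * hch
    have hY : z (some (.inl 1)) = P * y + Q * y' := by
      rw [hp, hq]
      linear_combination -z (some (.inl 1)) * hxy - y * y' * z (some (.inl 0)) * hch
    rw [hX, hY]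
    simp only [CharTwo.add_sq]
    have e4 : c₂ * c₃ * (1 * P ^ 2 + P * q z + c₂ * c₃ * g * q z ^ 2) =
        c₂ * c₃ * P ^ 2 + P * Q + g * Q ^ 2 := by rw [hQ]; ring
    rw [e4, hg]
    linear_combination P ^ 2 * h - P * Q * hxy +
      P ^ 2 * (c₂ * c₃ - a * x ^ 2 - x * y - b * y ^ 2) * hch
  refine ⟨2, ![Units.mk0 c₂ h₂, Units.mk0 c₃ h₃], c₂ * c₃ * g, ?_, Units.mk0 ε⁻¹ (inv_ne_zero hε),
    G.comp L.symm.toLinearMap, ?_, ?_⟩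
  · rw [← L.finrank_eq]
    simp
  all_goals
    have hval : ∀ v, ε⁻¹ * φ v = pfisterQF 2 (fun i => ((![Units.mk0 c₂ h₂, Units.mk0 c₃ h₃] i :
        Fˣ) : F)) (c₂ * c₃ * g) (G (L.symm v)) := by
      intro v
      have e : (fun i => ((![Units.mk0 c₂ h₂, Units.mk0 c₃ h₃] i : Fˣ) : F)) = ![c₂, c₃] := by
        funext i; fin_cases i <;> rfl
      rw [e, hG]
      have := hL (L.symm v)
      rw [L.apply_symm_apply] at this
      rw [this]
      field_simp
  · refine (injective_iff_map_eq_zero _).2 fun v hv => hφ v ?_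
    have := hval v
    rw [show G (L.symm v) = 0 from hv, QuadraticMap.map_zero] at this
    simpa [hε] using this
  · exact hval

theorem sqAniso_of_not_isPfisterNeighbour {V : Type} [AddCommGroup V] [Module F V]
    {φ : QuadraticForm F V} (hφ : φ.Anisotropic) {ε : F} (hε : ε ≠ 0)
    {L : (Option (Fin 2 ⊕ Fin 2) → F) ≃ₗ[F] V}
    (hL : ∀ x, φ (L x) = ε * normalForm a b ![c₂, c₃] x) (hpn : ¬ IsPfisterNeighbour φ) :
    SqAniso a b c₂ c₃ := by
  have hch : (2 : F) = 0 := CharTwo.two_eq_zero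
  have hnf := eq_zero_of_normalForm hφ hL
  intro x y k hk
  have h3 : k 3 = 0 := by
    by_contra h3
    have hsq := @eq_zero_of_sqForm_of_normalForm F _ _ a b c₂ c₃ hnf
    have h₂ : c₂ ≠ 0 := by
      rintro rfl
      simpa using congrFun (hsq (k := ![0, 1, 0, 0]) (by simp [sqForm_apply])) 1
    have h₃ : c₃ ≠ 0 := by
      rintro rfl
      simpa using congrFun (hsq (k := ![0, 0, 1, 0]) (by simp [sqForm_apply])) 2
    have hval : a * (x / k 3) ^ 2 + x / k 3 * (y / k 3) + b * (y / k 3) ^ 2 +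
        ((k 0 / k 3) ^ 2 + c₂ * (k 1 / k 3) ^ 2 + c₃ * (k 2 / k 3) ^ 2) = c₂ * c₃ := by
      rw [sqForm_apply] at hk
      field_simp
      linear_combination hk - c₂ * c₃ * k 3 ^ 2 * hch
    by_cases hx : x = 0
    · have hy : y ≠ 0 := by
        rintro rfl
        exact h3 (congrFun (hsq (k := k) (by simpa [hx] using hk)) 3)
      exact hpn (isPfisterNeighbour_of_normalForm hφ hε hL h₂ h₃ (x' := k 3 / y) (y' := 0)
        (by field_simp; simp) hval)
    · exact hpn (isPfisterNeighbour_of_normalForm hφ hε hL h₂ h₃ (x' := 0) (y' := k 3 / x)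
        (by field_simp; simp) hval)
  rw [sqForm_apply, h3] at hk
  have h0 := hnf (fun i => i.elim (k 0) (Sum.elim ![x, y] ![k 1, k 2])) (by
    simp [normalForm, Fin.sum_univ_two]
    linear_combination hk)
  refine ⟨congrFun h0 (some (.inl 0)), congrFun h0 (some (.inl 1)), ?_⟩
  funext i
  fin_cases i
  · exact congrFun h0 none
  · exact congrFun h0 (some (.inr 0))
  · exact congrFun h0 (some (.inr 1))
  · exact h3

end NormalForm

section FunctionField

variable {F : Type} [Field F]

theorem sum_coeffMat {n : ℕ} (ψ : QuadraticForm F (Fin n → F)) (x : Fin n → F) :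
    ∑ i, ∑ j, coeffMat F ψ i j * (x i * x j) = ψ x := by
  conv_rhs => rw [← toQuadraticMap_toBilin ψ (Pi.basisFun F (Fin n))]
  rw [LinearMap.BilinMap.toQuadraticMap_apply,
    ← LinearMap.sum_repr_mul_repr_mul (Pi.basisFun F (Fin n)) (Pi.basisFun F (Fin n)) x x,
    Finsupp.sum_fintype _ _ (by simp)]
  refine Finset.sum_congr rfl fun i _ => ?_
  rw [Finsupp.sum_fintype _ _ (by simp)]
  refine Finset.sum_congr rfl fun j _ => ?_
  rw [toBilin_apply]
  simp only [Pi.basisFun_repr, Pi.basisFun_apply, smul_eq_mul, coeffMat, Matrix.of_apply]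
  ring

theorem eval_qfPoly {n : ℕ} (ψ : QuadraticForm F (Fin n → F)) (x : Fin n → F) :
    eval x (qfPoly F ψ) = ψ x := by
  simp [qfPoly, ← sum_coeffMat ψ x]

/-- An isotropic vector over the function field can be taken to have polynomial entries. -/
theorem exists_qfPoly_dvd_of_not_anisotropic {n m : ℕ} {φ : QuadraticForm F (Fin m → F)}
    {ψ : QuadraticForm F (Fin n → F)} (h : ¬ (extendQF F (funFieldMap F ψ) φ).Anisotropic) :
    ∃ w : Fin m → MvPolynomial (Fin n) F, ¬ (∀ i, qfPoly F ψ ∣ w i) ∧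
      qfPoly F ψ ∣ ∑ i, ∑ j, C (coeffMat F φ i j) * (w i * w j) := by
  simp only [QuadraticMap.Anisotropic, not_forall] at h
  obtain ⟨v, hv, hv0⟩ := h
  rw [extendQF, toQuadraticMap'_apply] at hv
  have : IsFractionRing (FunFieldRing F ψ) (FunField F ψ) :=
    inferInstanceAs (IsFractionRing (FunFieldRing F ψ) (FractionRing (FunFieldRing F ψ)))
  obtain ⟨b, hb⟩ := IsLocalization.exist_integer_multiples_of_finite
    (nonZeroDivisors (FunFieldRing F ψ)) v
  choose u hu using hb
  let π : MvPolynomial (Fin n) F →+* FunFieldRing F ψ :=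
    Ideal.Quotient.mk (Ideal.span {qfPoly F ψ})
  have hπ : ∀ p, π p = 0 ↔ qfPoly F ψ ∣ p := fun p =>
    Ideal.Quotient.eq_zero_iff_mem.trans Ideal.mem_span_singleton
  have hsurj : Function.Surjective π := Ideal.Quotient.mk_surjective
  choose w hw using fun i => hsurj (u i)
  have hinj := IsFractionRing.injective (FunFieldRing F ψ) (FunField F ψ)
  have hbu : IsUnit (algebraMap (FunFieldRing F ψ) (FunField F ψ) b) :=
    IsLocalization.map_units _ b
  have hmap : ∀ r, funFieldMap F ψ r =
      algebraMap (FunFieldRing F ψ) (FunField F ψ) (π (C r)) := fun r => rfl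
  refine ⟨w, fun hdvd => hv0 (funext fun i => ?_), ?_⟩
  · have h0 := hu i
    rw [← hw, (hπ _).2 (hdvd i), map_zero, Algebra.smul_def] at h0
    exact (hbu.mul_right_eq_zero.1 h0.symm)
  · rw [← hπ]
    apply hinj
    have : ∀ i, algebraMap (FunFieldRing F ψ) (FunField F ψ) (π (w i)) =
        algebraMap (FunFieldRing F ψ) (FunField F ψ) b * v i := fun i => by
      rw [hw, hu, ← Algebra.smul_def]
    simp only [map_sum, map_mul, this, ← hmap, map_zero]
    rw [← mul_zero (algebraMap (FunFieldRing F ψ) (FunField F ψ) b ^ 2), ← hv, Finset.mul_sum]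
    refine Finset.sum_congr rfl fun i _ => ?_
    rw [Finset.mul_sum]
    refine Finset.sum_congr rfl fun j _ => ?_
    rw [Matrix.map_apply]
    ring

theorem isotropicModulo_of_not_anisotropic [Infinite F] {n m : ℕ}
    {φ : QuadraticForm F (Fin m → F)} {ψ : QuadraticForm F (Fin n → F)} {ε a b c₂ c₃ : F}
    (hε : ε ≠ 0) {L : (Option (Fin 2 ⊕ Fin 2) → F) ≃ₗ[F] (Fin m → F)}
    (hL : ∀ x, φ (L x) = ε * normalForm a b ![c₂, c₃] x)
    (h : ¬ (extendQF F (funFieldMap F ψ) φ).Anisotropic) :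
    IsotropicModulo a b c₂ c₃ (qfPoly F ψ) := by
  obtain ⟨w, hw, hd⟩ := exists_qfPoly_dvd_of_not_anisotropic h
  let w' : Option (Fin 2 ⊕ Fin 2) → MvPolynomial (Fin n) F := fun k =>
    aeval w (linearSubst L.symm.toLinearMap (X k))
  have heval : ∀ {κ : Type} (g : κ → MvPolynomial (Fin n) F) (ζ : Fin n → F) (p : MvPolynomial κ F),
      eval ζ (aeval g p) = eval (fun k => eval ζ (g k)) p := fun g ζ p => by
    rw [← coe_aeval_eq_eval, ← coe_aeval_eq_eval]
    exact comp_aeval_apply g (aeval ζ) p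
  have hw' : ∀ ζ k, eval ζ (w' k) = L.symm (fun i => eval ζ (w i)) k := fun ζ k => by
    rw [← eval_X (f := L.symm fun i => eval ζ (w i)) k]
    exact (heval w ζ _).trans (eval_linearSubst L.symm.toLinearMap _ _)
  have hback : ∀ i, w i = aeval w' (linearSubst L.toLinearMap (X i)) := fun i => by
    refine MvPolynomial.funext fun ζ => ?_
    rw [heval, eval_linearSubst, eval_X, funext (hw' ζ)]
    exact (congrFun (L.apply_symm_apply fun i => eval ζ (w i)) i).symm
  refine ⟨w' (some (.inl 0)), w' (some (.inl 1)),
    ![w' none, w' (some (.inr 0)), w' (some (.inr 1))], fun ⟨hx, hy, hu⟩ => hw fun i => ?_, ?_⟩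
  · have hall : ∀ k, qfPoly F ψ ∣ w' k := by
      rintro (_ | k | k)
      · exact hu 0
      · fin_cases k
        exacts [hx, hy]
      · fin_cases k
        exacts [hu 1, hu 2]
    rw [hback, linearSubst, aeval_X, map_sum]
    refine Finset.dvd_sum fun k _ => ?_
    rw [map_mul, aeval_X]
    exact (hall k).mul_left _
  · convert hd.mul_left (C ε⁻¹) using 1
    refine MvPolynomial.funext fun ζ => ?_
    have key := hL (L.symm fun i => eval ζ (w i))
    rw [L.apply_symm_apply, ← sum_coeffMat] at key
    simp only [map_mul, map_sum, eval_C, map_add, map_pow, triForm]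
    rw [key, inv_mul_cancel_left₀ hε]
    simp [normalForm, hw', Fin.sum_univ_two]
    ring

end FunctionField

theorem stmt1 (F : Type) [Field F] [CharP F 2]
    (φ : QuadraticForm F (Fin 5 → F)) (hφa : φ.Anisotropic) (hφt : HasTypeRS φ 1 3)
    (hφpn : ¬ IsPfisterNeighbour φ)
    (s : ℕ) (hs : 4 ≤ s) (ψ : QuadraticForm F (Fin (2 + s) → F))
    (hψa : ψ.Anisotropic) (hψt : HasTypeRS ψ 1 s) :
    (extendQF F (funFieldMap F ψ) φ).Anisotropic := by
  by_contra hiso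
  obtain ⟨m, rfl⟩ : ∃ m, s = m + 1 := ⟨s - 1, by omega⟩
  obtain ⟨ε, a, b, c, L, hε, hL⟩ := hφt.exists_normalForm hφa
  rw [show c = ![c 0, c 1] by funext i; fin_cases i <;> rfl] at hL
  have hsq := sqAniso_of_not_isPfisterNeighbour hφa hε hL hφpn
  have := hsq.infinite
  obtain ⟨ρ, e, f, d, M, hρ, hM⟩ := hψt.exists_normalForm hψa
  have hP : ∀ x, eval x (X none ^ 2 + rename some (innerPoly e f d)) = normalForm e f d x := by
    intro x
    simp only [map_add, map_pow, eval_X, eval_rename]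
    simp [innerPoly, normalForm]
    ring
  refine hsq.not_isotropicModulo (by omega) (eq_zero_of_normalForm hψa hM) hP
    ((isotropicModulo_of_not_anisotropic hε hL hiso).transfer hρ M fun x => ?_)
  rw [hP, eval_qfPoly, hM]
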